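/- arXiv:1109.1006 — 4 statements merged into one kernel-verified Lean document; each statement's English description precedes it below -/
import Mathlib

section
/- (Varopoulos' lemma, converse with constant 2.) Suppose that for every pair of measurable sets E₁ ⊆ Ω₁ and E₂ ⊆ Ω₂ of finite measure one has ∫_{E₁×E₂} |f| d(μ₁×μ₂) ≤ μ₁(E₁) + μ₂(E₂). Then there exist measurable functions f₁, f₂ on Ω₁ × Ω₂ with f = f₁ + f₂ (μ₁×μ₂)-almost everywhere and ‖f₁‖_{L_∞(μ₁;L_1(μ₂))} + ‖f₂‖_{L_∞(μ₂;L_1(μ₁))} ≤ 2. -/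
open MeasureTheory ENNReal

open Filter Topology in
theorem vW_lemma {α : Type*} [MeasurableSpace α] (ρ : Measure α) [SFinite ρ]
    (D : ℕ → Set (α → ℝ))
    (hD : ∀ n, ∀ θ ∈ D n, Measurable θ ∧ ∀ x, 0 ≤ θ x ∧ θ x ≤ 1)
    (hanti : ∀ n m, n ≤ m → D m ⊆ D n)
    (hmid : ∀ n, ∀ θ ∈ D n, ∀ η ∈ D n, (fun x => (1/2 : ℝ) * (θ x + η x)) ∈ D n)
    (hcl : ∀ n, ∀ (u : ℕ → α → ℝ) (θ : α → ℝ), (∀ k, u k ∈ D n) → Measurable θ →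
      (∀ x, 0 ≤ θ x ∧ θ x ≤ 1) → (∀ᵐ x ∂ρ, Tendsto (fun k => u k x) atTop (𝓝 (θ x))) → θ ∈ D n)
    (hne : ∀ n, (D n).Nonempty) : ∃ θ, ∀ n, θ ∈ D n := by
  classical
  set P := ρ.toFinite with hP
  have hmem : ∀ n, ∀ θ ∈ D n, MemLp θ 2 P := fun n θ hθ =>
    MemLp.of_bound (hD n θ hθ).1.aestronglyMeasurable 1 (Eventually.of_forall fun x => by
      rw [Real.norm_eq_abs, abs_le]; have := (hD n θ hθ).2 x; constructor <;> linarith)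
  let S : ℕ → Set ℝ := fun n => {r | ∃ (θ : α → ℝ) (h : θ ∈ D n), r = ‖(hmem n θ h).toLp θ‖ ^ 2}
  have hSne : ∀ n, (S n).Nonempty := fun n => by
    obtain ⟨θ, h⟩ := hne n
    exact ⟨_, θ, h, rfl⟩
  have hSbdd : ∀ n, BddBelow (S n) := fun n => ⟨0, by rintro r ⟨θ, h, rfl⟩; positivity⟩
  have hSanti : ∀ n m, n ≤ m → S m ⊆ S n := by
    rintro n m hnm r ⟨θ, h, rfl⟩
    exact ⟨θ, hanti n m hnm h, rfl⟩
  have hmmono : Monotone (fun n => sInf (S n)) := fun n m hnm =>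
    csInf_le_csInf (hSbdd n) (hSne m) (hSanti n m hnm)
  obtain ⟨C, hC⟩ : ∃ C : ℝ, ∀ n, sInf (S n) ≤ C := by
    have h1 : MemLp (fun _ : α => (1:ℝ)) 2 P := memLp_const 1
    refine ⟨‖h1.toLp _‖ ^ 2, fun n => ?_⟩
    obtain ⟨θ, h⟩ := hne n
    refine (csInf_le (hSbdd n) ⟨θ, h, rfl⟩).trans ?_
    gcongr
    apply Lp.norm_le_norm_of_ae_le
    filter_upwards [(hmem n θ h).coeFn_toLp, h1.coeFn_toLp] with x hx1 hx2
    rw [hx1, hx2, Real.norm_eq_abs, Real.norm_eq_abs, abs_one, abs_le]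
    have := (hD n θ h).2 x; constructor <;> linarith
  have hlim := tendsto_atTop_ciSup hmmono ⟨C, by rintro _ ⟨n, rfl⟩; exact hC n⟩
  set m := ⨆ n, sInf (S n)
  have hle : ∀ n, sInf (S n) ≤ m := fun n => hmmono.ge_of_tendsto hlim n
  have hpick : ∀ n, ∃ (θ : α → ℝ) (h : θ ∈ D n), ‖(hmem n θ h).toLp θ‖ ^ 2 < sInf (S n) + 1 / ((n:ℝ) + 1) := by
    intro n
    have : sInf (S n) < sInf (S n) + 1 / ((n:ℝ) + 1) := by
      have : 0 < 1 / ((n:ℝ) + 1) := by positivity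
      linarith
    obtain ⟨r, ⟨θ, h, rfl⟩, hr⟩ := exists_lt_of_csInf_lt (hSne n) this
    exact ⟨θ, h, hr⟩
  choose u hu hun using hpick
  let U : ℕ → Lp ℝ 2 P := fun n => (hmem n (u n) (hu n)).toLp (u n)
  have key : ∀ n k, n ≤ k → ‖U n - U k‖ ^ 2 ≤ 2 * (m - sInf (S n)) + 4 / ((n:ℝ) + 1) := by
    intro n k hnk
    have hk : u k ∈ D n := hanti n k hnk (hu k)
    have hm := hmid n _ (hu n) _ hk
    have h1 : sInf (S n) ≤ ‖(1/2 : ℝ) • (U n + U k)‖ ^ 2 := csInf_le (hSbdd n) ⟨_, hm, rfl⟩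
    rw [norm_smul, mul_pow] at h1
    norm_num at h1
    have h2 := parallelogram_law_with_norm ℝ (U n) (U k)
    have h3 := hun n
    have h4 := hun k
    have h5 : 1 / ((k:ℝ) + 1) ≤ 1 / ((n:ℝ) + 1) := by
      apply one_div_le_one_div_of_le (by positivity)
      have : (n:ℝ) ≤ k := by exact_mod_cast hnk
      linarith
    have h6 := hle k
    have h7 : 4 / ((n:ℝ) + 1) = 4 * (1 / ((n:ℝ)+1)) := by ring
    rw [h7]
    change ‖U n‖ ^ 2 < _ at h3
    change ‖U k‖ ^ 2 < _ at h4
    nlinarith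
  have hcau : CauchySeq U := by
    have hb : Tendsto (fun n : ℕ => Real.sqrt (2 * (m - sInf (S n)) + 4 / ((n:ℝ) + 1))) atTop (𝓝 0) := by
      have h1 : Tendsto (fun n : ℕ => 2 * (m - sInf (S n)) + 4 * (1 / ((n:ℝ) + 1))) atTop (𝓝 (2 * (m - m) + 4 * 0)) :=
        ((hlim.const_sub m).const_mul 2).add (tendsto_one_div_add_atTop_nhds_zero_nat.const_mul 4)
      have h2 := h1.sqrt
      simp only [sub_self, mul_zero, add_zero, Real.sqrt_zero] at h2
      refine h2.congr fun n => ?_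
      congr 2; ring
    rw [Metric.cauchySeq_iff']
    intro ε hε
    obtain ⟨N, hN⟩ := (hb.eventually (gt_mem_nhds hε)).exists
    refine ⟨N, fun n hn => lt_of_le_of_lt ?_ hN⟩
    rw [dist_comm, dist_eq_norm]
    exact Real.le_sqrt_of_sq_le (key N n hn)
  obtain ⟨V, hV⟩ := cauchySeq_tendsto_of_complete hcau
  obtain ⟨φ, hφ, hae⟩ := (tendstoInMeasure_of_tendsto_Lp hV).exists_seq_tendsto_ae
  have hVm : Measurable (fun x => max 0 (min 1 (V x))) := by
    have := (Lp.stronglyMeasurable V).measurable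
    fun_prop
  refine ⟨fun x => max 0 (min 1 (V x)), fun n => hcl n (fun k => u (φ (k + n))) _ (fun k => ?_) hVm (fun x => ⟨le_max_left _ _, by simp⟩) ?_⟩
  · exact hanti n _ ((Nat.le_add_left n k).trans (hφ.id_le _)) (hu _)
  · rw [← ae_toFinite]
    have hall : ∀ᵐ x ∂P, ∀ k, U k x = u k x := ae_all_iff.2 fun k => (hmem k (u k) (hu k)).coeFn_toLp
    filter_upwards [hae, hall] with x hx hx2
    have h1 : Tendsto (fun k => u (φ (k + n)) x) atTop (𝓝 (V x)) := by
      have := hx.comp (tendsto_add_atTop_nat n)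
      refine this.congr fun k => ?_
      simp [hx2]
    have h2 : Tendsto (fun k => max 0 (min 1 (u (φ (k + n)) x))) atTop (𝓝 (max 0 (min 1 (V x)))) :=
      (tendsto_const_nhds.max (tendsto_const_nhds.min h1))
    refine h2.congr fun k => ?_
    have := (hD _ _ (hu (φ (k+n)))).2 x
    rw [min_eq_right this.2, max_eq_right this.1]

/-- Bounded measurable functions. -/
def VBM {α : Type*} [MeasurableSpace α] (f : α → ℝ) : Prop :=
  Measurable f ∧ ∃ C : ℝ, ∀ x, |f x| ≤ C

namespace VBM
variable {α β : Type*} [MeasurableSpace α] [MeasurableSpace β] {f g : α → ℝ}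

theorem int (hf : VBM f) (μ : Measure α) [IsFiniteMeasure μ] : Integrable f μ := by
  obtain ⟨h, C, hC⟩ := hf
  exact Integrable.of_bound h.aestronglyMeasurable C (Filter.Eventually.of_forall hC)

theorem add (hf : VBM f) (hg : VBM g) : VBM (fun x => f x + g x) := by
  obtain ⟨h, C, hC⟩ := hf
  obtain ⟨h', C', hC'⟩ := hg
  exact ⟨h.add h', C + C', fun x => (abs_add_le _ _).trans (add_le_add (hC x) (hC' x))⟩

theorem mul (hf : VBM f) (hg : VBM g) : VBM (fun x => f x * g x) := by
  obtain ⟨h, C, hC⟩ := hf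
  obtain ⟨h', C', hC'⟩ := hg
  refine ⟨h.mul h', C * C', fun x => ?_⟩
  rw [abs_mul]
  exact mul_le_mul (hC x) (hC' x) (abs_nonneg _) ((abs_nonneg _).trans (hC x))

theorem const (c : ℝ) : VBM (fun _ : α => c) := ⟨measurable_const, |c|, fun _ => le_rfl⟩

theorem sub (hf : VBM f) (hg : VBM g) : VBM (fun x => f x - g x) := by
  have := hf.add ((const (-1)).mul hg)
  refine (congrArg VBM (funext fun x => ?_)).mp this
  ring

theorem comp (hf : VBM f) {u : β → α} (hu : Measurable u) : VBM (fun x => f (u x)) :=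
  ⟨hf.1.comp hu, hf.2.imp fun _ hC x => hC (u x)⟩

theorem ind {s : Set α} (hs : MeasurableSet s) : VBM (s.indicator (fun _ => (1:ℝ))) := by
  refine ⟨measurable_const.indicator hs, 1, fun x => ?_⟩
  by_cases h : x ∈ s <;> simp [h]

theorem unit (h : Measurable f) (h1 : ∀ x, 0 ≤ f x ∧ f x ≤ 1) : VBM f :=
  ⟨h, 1, fun x => abs_le.2 ⟨by linarith [(h1 x).1], (h1 x).2⟩⟩

theorem sec (μ : Measure β) [IsFiniteMeasure μ] {k : α × β → ℝ} (hk : VBM k) :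
    VBM (fun x => ∫ y, k (x, y) ∂μ) := by
  obtain ⟨h, C, hC⟩ := hk
  refine ⟨h.stronglyMeasurable.integral_prod_right'.measurable, C * μ.real Set.univ, fun x => ?_⟩
  have := norm_integral_le_of_norm_le_const (μ := μ) (f := fun y => k (x, y)) (C := C)
    (Filter.Eventually.of_forall fun y => by rw [Real.norm_eq_abs]; exact hC (x, y))
  exact this

theorem sec' (μ : Measure α) [IsFiniteMeasure μ] {k : α × β → ℝ} (hk : VBM k) :
    VBM (fun y => ∫ x, k (x, y) ∂μ) :=
  sec μ (hk.comp measurable_swap)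

theorem fub (μ : Measure α) (ν : Measure β) [IsFiniteMeasure μ] [IsFiniteMeasure ν]
    {c : α → ℝ} {k : α × β → ℝ} (hc : VBM c) (hk : VBM k) :
    ∫ x, c x * ∫ y, k (x, y) ∂ν ∂μ = ∫ p, c p.1 * k p ∂(μ.prod ν) := by
  rw [integral_prod _ (((hc.comp measurable_fst).mul hk).int _)]
  simp only [integral_const_mul]

theorem fub' (μ : Measure α) (ν : Measure β) [IsFiniteMeasure μ] [IsFiniteMeasure ν]
    {c : β → ℝ} {k : α × β → ℝ} (hc : VBM c) (hk : VBM k) :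
    ∫ y, c y * ∫ x, k (x, y) ∂μ ∂ν = ∫ p, c p.2 * k p ∂(μ.prod ν) := by
  rw [integral_prod_symm _ (((hc.comp measurable_snd).mul hk).int _)]
  simp only [integral_const_mul]

theorem sqexp (τ : Measure α) [IsFiniteMeasure τ] {a c : α → ℝ} (t : ℝ) (ha : VBM a)
    (hc : VBM c) : ∫ x, (a x + t * c x) ^ 2 ∂τ
        = ∫ x, (a x) ^ 2 ∂τ + 2 * t * ∫ x, a x * c x ∂τ + t ^ 2 * ∫ x, (c x) ^ 2 ∂τ := by
  have h1 := (ha.mul ha).int τ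
  have h2 := ((VBM.const (2 * t)).mul (ha.mul hc)).int τ
  have h3 := ((VBM.const (t^2)).mul (hc.mul hc)).int τ
  simp only [pow_two (a _), pow_two (c _)]
  rw [← integral_const_mul, ← integral_const_mul, ← integral_add h1 h2,
    ← integral_add ((ha.mul ha).add ((VBM.const (2 * t)).mul (ha.mul hc)) |>.int τ) h3]
  congr 1; ext x; ring

end VBM

/-- The energy. -/
noncomputable def vF {X Y : Type*} [MeasurableSpace X] [MeasurableSpace Y] (μ : Measure X)
    (ν : Measure Y) (g θ : X × Y → ℝ) : ℝ :=
  ∫ x, (∫ y, θ (x, y) * g (x, y) ∂ν) ^ 2 ∂μ + ∫ y, (∫ x, (1 - θ (x, y)) * g (x, y) ∂μ) ^ 2 ∂ν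

section fin
variable {X Y : Type*} [MeasurableSpace X] [MeasurableSpace Y] {μ : Measure X}
    {ν : Measure Y} [IsFiniteMeasure μ] [IsFiniteMeasure ν] {g : X × Y → ℝ}

theorem vF_expand (hg : VBM g) {θ δ : X × Y → ℝ} (hθ : VBM θ) (hδ : VBM δ) (s : ℝ) :
    vF μ ν g (fun p => θ p + s * δ p) = vF μ ν g θ
      + 2 * s * ∫ p, ((∫ y, θ (p.1, y) * g (p.1, y) ∂ν) - (∫ x, (1 - θ (x, p.2)) * g (x, p.2) ∂μ))
          * (δ p * g p) ∂(μ.prod ν)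
      + s ^ 2 * (∫ x, (∫ y, δ (x, y) * g (x, y) ∂ν) ^ 2 ∂μ
          + ∫ y, (∫ x, δ (x, y) * g (x, y) ∂μ) ^ 2 ∂ν) := by
  have hθg := hθ.mul hg
  have hθg' := ((VBM.const 1).sub hθ).mul hg
  have hδg := hδ.mul hg
  have ha := hθg.sec ν
  have hb := hθg'.sec' μ
  have hA := hδg.sec ν
  have hB := hδg.sec' μ
  have e1 : ∀ x, ∫ y, (θ (x, y) + s * δ (x, y)) * g (x, y) ∂ν
      = (∫ y, θ (x, y) * g (x, y) ∂ν) + s * ∫ y, δ (x, y) * g (x, y) ∂ν := by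
    intro x
    rw [← integral_const_mul, ← integral_add]
    · congr 1; ext y; ring
    · exact (hθg.comp measurable_prodMk_left).int ν
    · exact ((hδg.comp measurable_prodMk_left).int ν).const_mul s
  have e2 : ∀ y, ∫ x, (1 - (θ (x, y) + s * δ (x, y))) * g (x, y) ∂μ
      = (∫ x, (1 - θ (x, y)) * g (x, y) ∂μ) - s * ∫ x, δ (x, y) * g (x, y) ∂μ := by
    intro x
    rw [← integral_const_mul, ← integral_sub]
    · congr 1; ext y; ring
    · exact (hθg'.comp measurable_prodMk_right).int μ
    · exact ((hδg.comp measurable_prodMk_right).int μ).const_mul s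
  have e3 : ∫ p, ((∫ y, θ (p.1, y) * g (p.1, y) ∂ν) - (∫ x, (1 - θ (x, p.2)) * g (x, p.2) ∂μ))
          * (δ p * g p) ∂(μ.prod ν)
      = ∫ x, (∫ y, θ (x, y) * g (x, y) ∂ν) * (∫ y, δ (x, y) * g (x, y) ∂ν) ∂μ
        - ∫ y, (∫ x, (1 - θ (x, y)) * g (x, y) ∂μ) * (∫ x, δ (x, y) * g (x, y) ∂μ) ∂ν := by
    rw [VBM.fub μ ν ha hδg, VBM.fub' μ ν hb hδg, ← integral_sub]
    · congr 1; ext p; ring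
    · exact ((ha.comp measurable_fst).mul hδg).int _
    · exact ((hb.comp measurable_snd).mul hδg).int _
  rw [e3]
  unfold vF
  simp only [e1, e2]
  have r1 := VBM.sqexp μ s ha hA
  have r2 := VBM.sqexp ν (-s) hb hB
  simp only [neg_mul, ← sub_eq_add_neg] at r2
  rw [r1, r2]
  ring

end fin

section fin2
variable {X Y : Type*} [MeasurableSpace X] [MeasurableSpace Y] {μ : Measure X}
    {ν : Measure Y} [IsFiniteMeasure μ] [IsFiniteMeasure ν] {g : X × Y → ℝ}

theorem vF_nonneg (θ : X × Y → ℝ) : 0 ≤ vF μ ν g θ := by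
  unfold vF
  have := integral_nonneg (μ := μ) (f := fun x => (∫ y, θ (x, y) * g (x, y) ∂ν) ^ 2)
    (fun x => sq_nonneg _)
  have := integral_nonneg (μ := ν) (f := fun y => (∫ x, (1 - θ (x, y)) * g (x, y) ∂μ) ^ 2)
    (fun x => sq_nonneg _)
  linarith

theorem vF_mid (hg : VBM g) {θ η : X × Y → ℝ} (hθ : VBM θ) (hη : VBM η) :
    vF μ ν g (fun p => (1/2 : ℝ) * (θ p + η p)) ≤ (vF μ ν g θ + vF μ ν g η) / 2 := by
  have hδ := hη.sub hθ
  have h1 := vF_expand (μ := μ) (ν := ν) hg hθ hδ 1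
  have h2 := vF_expand (μ := μ) (ν := ν) hg hθ hδ (1/2)
  have e1 : (fun p => θ p + 1 * (η p - θ p)) = η := by ext p; ring
  have e2 : (fun p => θ p + 1/2 * (η p - θ p)) = (fun p => (1/2 : ℝ) * (θ p + η p)) := by
    ext p; ring
  rw [e1] at h1
  rw [e2] at h2
  have p1 := integral_nonneg (μ := μ) (f := fun x => (∫ y, (η (x, y) - θ (x, y)) * g (x, y) ∂ν) ^ 2)
    (fun x => sq_nonneg _)
  have p2 := integral_nonneg (μ := ν) (f := fun y => (∫ x, (η (x, y) - θ (x, y)) * g (x, y) ∂μ) ^ 2)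
    (fun x => sq_nonneg _)
  linarith

open Filter Topology

theorem v_tend (hg : VBM g) (u : ℕ → X × Y → ℝ) (θ : X × Y → ℝ)
    (hu : ∀ k, Measurable (u k) ∧ ∀ x, 0 ≤ u k x ∧ u k x ≤ 1)
    (hlim : ∀ᵐ p ∂(μ.prod ν), Tendsto (fun k => u k p) atTop (𝓝 (θ p))) :
    Tendsto (fun k => ∫ x, (∫ y, u k (x, y) * g (x, y) ∂ν) ^ 2 ∂μ) atTop
      (𝓝 (∫ x, (∫ y, θ (x, y) * g (x, y) ∂ν) ^ 2 ∂μ)) := by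
  obtain ⟨C, hC⟩ := hg.2
  have hm : ∀ k, VBM (fun p => u k p * g p) := fun k => (VBM.unit (hu k).1 (hu k).2).mul hg
  have hb : ∀ k p, ‖u k p * g p‖ ≤ C := by
    intro k p
    rw [Real.norm_eq_abs, abs_mul, abs_of_nonneg ((hu k).2 p).1]
    have := hC p
    have := (hu k).2 p
    nlinarith [abs_nonneg (g p)]
  refine tendsto_integral_of_dominated_convergence (fun _ => (C * ν.real Set.univ) ^ 2) ?_ ?_ ?_ ?_
  · intro k
    exact (((hm k).sec ν).1.pow_const 2).aestronglyMeasurable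
  · exact integrable_const _
  · intro k
    refine Eventually.of_forall fun x => ?_
    have := norm_integral_le_of_norm_le_const (μ := ν) (f := fun y => u k (x, y) * g (x, y)) (C := C)
      (Eventually.of_forall fun y => hb k (x, y))
    rw [norm_pow]
    gcongr
  · filter_upwards [Measure.ae_ae_of_ae_prod hlim] with x hx
    refine Tendsto.pow ?_ 2
    refine tendsto_integral_of_dominated_convergence (fun _ => C) ?_ (integrable_const _) ?_ ?_
    · intro k
      exact ((hm k).comp measurable_prodMk_left).1.aestronglyMeasurable
    · intro k
      exact Eventually.of_forall fun y => hb k (x, y)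
    · filter_upwards [hx] with y hy
      exact hy.mul_const _

theorem v_swap_ae {P : X × Y → Prop} (h : ∀ᵐ p ∂(μ.prod ν), P p) :
    ∀ᵐ q ∂(ν.prod μ), P q.swap := by
  rw [← Measure.prod_swap] at h
  exact ae_of_ae_map measurable_swap.aemeasurable h

theorem vF_tend (hg : VBM g) (u : ℕ → X × Y → ℝ) (θ : X × Y → ℝ)
    (hu : ∀ k, Measurable (u k) ∧ ∀ x, 0 ≤ u k x ∧ u k x ≤ 1)
    (hlim : ∀ᵐ p ∂(μ.prod ν), Tendsto (fun k => u k p) atTop (𝓝 (θ p))) :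
    Tendsto (fun k => vF μ ν g (u k)) atTop (𝓝 (vF μ ν g θ)) := by
  refine (v_tend hg u θ hu hlim).add ?_
  have h := v_tend (μ := ν) (ν := μ) (hg.comp measurable_swap) (fun k q => 1 - u k q.swap)
    (fun q => 1 - θ q.swap) (fun k => ⟨by
      have := (hu k).1
      fun_prop, fun x => by
      have := (hu k).2 x.swap
      constructor <;> linarith⟩) (by
      filter_upwards [v_swap_ae hlim] with q hq
      exact hq.const_sub 1)
  exact h

theorem vF_exists_min (hg : VBM g) : ∃ θ : X × Y → ℝ, Measurable θ ∧ (∀ p, 0 ≤ θ p ∧ θ p ≤ 1) ∧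
    ∀ η : X × Y → ℝ, Measurable η → (∀ p, 0 ≤ η p ∧ η p ≤ 1) → vF μ ν g θ ≤ vF μ ν g η := by
  let S : Set ℝ := {r | ∃ η : X × Y → ℝ, Measurable η ∧ (∀ p, 0 ≤ η p ∧ η p ≤ 1) ∧ r = vF μ ν g η}
  have hSb : BddBelow S := ⟨0, by rintro r ⟨η, _, _, rfl⟩; exact vF_nonneg η⟩
  have hSne : S.Nonempty := ⟨_, fun _ => 0, measurable_const, by simp, rfl⟩
  obtain ⟨θ, hθ⟩ := vW_lemma (μ.prod ν)
    (fun n => {η | Measurable η ∧ (∀ p, 0 ≤ η p ∧ η p ≤ 1) ∧ vF μ ν g η ≤ sInf S + 1 / ((n:ℝ) + 1)})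
    (fun n η h => ⟨h.1, h.2.1⟩)
    (by
      rintro n m hnm η ⟨h1, h2, h3⟩
      refine ⟨h1, h2, h3.trans ?_⟩
      have : (n:ℝ) ≤ m := by exact_mod_cast hnm
      gcongr)
    (by
      rintro n θ ⟨h1, h2, h3⟩ η ⟨k1, k2, k3⟩
      refine ⟨by fun_prop, fun p => ?_, ?_⟩
      · have := h2 p
        have := k2 p
        constructor <;> linarith
      · have := vF_mid (μ := μ) (ν := ν) hg (VBM.unit h1 h2) (VBM.unit k1 k2)
        linarith)
    (by
      intro n u θ hu h1 h2 hl
      refine ⟨h1, h2, ?_⟩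
      exact le_of_tendsto' (vF_tend hg u θ (fun k => ⟨(hu k).1, (hu k).2.1⟩) hl) fun k => (hu k).2.2)
    (by
      intro n
      have : sInf S < sInf S + 1 / ((n:ℝ) + 1) := by
        have : 0 < 1 / ((n:ℝ) + 1) := by positivity
        linarith
      obtain ⟨r, ⟨θ, h1, h2, rfl⟩, hr⟩ := exists_lt_of_csInf_lt hSne this
      exact ⟨θ, h1, h2, hr.le⟩)
  refine ⟨θ, (hθ 0).1, (hθ 0).2.1, fun η h1 h2 => ?_⟩
  refine le_trans ?_ (csInf_le hSb ⟨η, h1, h2, rfl⟩)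
  have := tendsto_one_div_add_atTop_nhds_zero_nat (𝕜 := ℝ).const_add (sInf S)
  rw [add_zero] at this
  exact ge_of_tendsto' this fun n => (hθ n).2.2

theorem v_fin (hg : VBM g) (hg0 : ∀ p, 0 ≤ g p)
    (hb : ∀ (E₁ : Set X) (E₂ : Set Y), MeasurableSet E₁ → MeasurableSet E₂ →
      ∫ p in E₁ ×ˢ E₂, g p ∂(μ.prod ν) ≤ μ.real E₁ + ν.real E₂) :
    ∃ θ : X × Y → ℝ, Measurable θ ∧ (∀ p, 0 ≤ θ p ∧ θ p ≤ 1) ∧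
      (∀ᵐ x ∂μ, ∫ y, θ (x, y) * g (x, y) ∂ν ≤ 1) ∧
      (∀ᵐ y ∂ν, ∫ x, (1 - θ (x, y)) * g (x, y) ∂μ ≤ 1) := by
  classical
  obtain ⟨θ, hm, h01, hmin⟩ := vF_exists_min (μ := μ) (ν := ν) hg
  refine ⟨θ, hm, h01, ?_⟩
  have hθ := VBM.unit hm h01
  have hθg := hθ.mul hg
  have hθg' := ((VBM.const 1).sub hθ).mul hg
  have hexp := fun δ hδ s => vF_expand (μ := μ) (ν := ν) hg hθ (δ := δ) hδ s
  have ha := hθg.sec ν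
  have hb' := hθg'.sec' μ
  set a := fun x => ∫ y, θ (x, y) * g (x, y) ∂ν with hadef
  set b := fun y => ∫ x, (1 - θ (x, y)) * g (x, y) ∂μ with hbdef
  set E₁ : Set X := {x | 1 < a x}
  set E₂ : Set Y := {y | 1 < b y}
  have hE₁ : MeasurableSet E₁ := measurableSet_lt measurable_const ha.1
  have hE₂ : MeasurableSet E₂ := measurableSet_lt measurable_const hb'.1
  let i₁ : X → ℝ := E₁.indicator (fun _ => 1)
  let i₂ : Y → ℝ := E₂.indicator (fun _ => 1)
  have hi₁ : VBM i₁ := VBM.ind hE₁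
  have hi₂ : VBM i₂ := VBM.ind hE₂
  -- competitor: moves mass off `E₁ × E₂ᶜ` and off `E₁ᶜ × E₂`
  let δ : X × Y → ℝ := fun p => (1 - i₁ p.1) * i₂ p.2 * (1 - θ p) - i₁ p.1 * (1 - i₂ p.2) * θ p
  have hδ : VBM δ := ((((VBM.const 1).sub (hi₁.comp measurable_fst)).mul (hi₂.comp measurable_snd)).mul
    ((VBM.const 1).sub hθ)).sub (((hi₁.comp measurable_fst).mul
      ((VBM.const 1).sub (hi₂.comp measurable_snd))).mul hθ)
  have hcases : ∀ p : X × Y, (0 ≤ θ p + δ p ∧ θ p + δ p ≤ 1) ∧ (a p.1 - b p.2) * (δ p * g p) ≤ 0 ∧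
      ((a p.1 - b p.2) * (δ p * g p) = 0 →
        i₁ p.1 * (θ p * g p) + i₂ p.2 * ((1 - θ p) * g p) = i₁ p.1 * i₂ p.2 * g p) := by
    intro p
    have hp := h01 p
    have hgp := hg0 p
    by_cases h1 : p.1 ∈ E₁ <;> by_cases h2 : p.2 ∈ E₂
    · simp only [δ, i₁, i₂, h1, h2, Set.indicator_of_mem]
      refine ⟨⟨by linarith, by linarith⟩, by simp, fun _ => by ring⟩
    · simp only [δ, i₁, i₂, h1, h2, Set.indicator_of_mem, Set.indicator_of_notMem, not_false_eq_true]
      have h1' : 1 < a p.1 := h1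
      have h2' : b p.2 ≤ 1 := not_lt.1 h2
      have hn : 0 ≤ θ p * g p := mul_nonneg hp.1 hgp
      refine ⟨⟨by linarith, by linarith⟩, by nlinarith, fun h => ?_⟩
      have h3 : (a p.1 - b p.2) * (θ p * g p) = 0 := by linarith
      rcases mul_eq_zero.1 h3 with h3 | h3
      · linarith
      · rw [h3]; ring
    · simp only [δ, i₁, i₂, h1, h2, Set.indicator_of_mem, Set.indicator_of_notMem, not_false_eq_true]
      have h1' : a p.1 ≤ 1 := not_lt.1 h1
      have h2' : 1 < b p.2 := h2
      have hn : 0 ≤ (1 - θ p) * g p := mul_nonneg (by linarith) hgp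
      refine ⟨⟨by linarith, by linarith⟩, by nlinarith, fun h => ?_⟩
      have h3 : (a p.1 - b p.2) * ((1 - θ p) * g p) = 0 := by linarith
      rcases mul_eq_zero.1 h3 with h3 | h3
      · linarith
      · rw [h3]; ring
    · simp only [δ, i₁, i₂, h1, h2, Set.indicator_of_notMem, not_false_eq_true]
      refine ⟨⟨by linarith, by linarith⟩, by simp, fun _ => by ring⟩
  have hVL : VBM (fun p : X × Y => (a p.1 - b p.2) * (δ p * g p)) :=
    ((ha.comp measurable_fst).sub (hb'.comp measurable_snd)).mul (hδ.mul hg)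
  have hL : 0 ≤ ∫ p, (a p.1 - b p.2) * (δ p * g p) ∂(μ.prod ν) := by
    by_contra hneg
    push Not at hneg
    set L := ∫ p, (a p.1 - b p.2) * (δ p * g p) ∂(μ.prod ν) with hLdef
    have hex := hexp δ hδ
    set Q := (∫ x, (∫ y, δ (x, y) * g (x, y) ∂ν) ^ 2 ∂μ
          + ∫ y, (∫ x, δ (x, y) * g (x, y) ∂μ) ^ 2 ∂ν) with hQ
    have hall : ∀ s : ℝ, 0 < s → s ≤ 1 → 0 ≤ 2 * L + s * Q := by
      intro s hs hs1
      have h1 := hmin (fun p => θ p + s * δ p) (hθ.add ((VBM.const s).mul hδ)).1 (fun p => by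
        have h1 := h01 p
        have h2 := (hcases p).1
        constructor <;> nlinarith)
      have h2 : vF μ ν g (fun p => θ p + s * δ p) = vF μ ν g θ + 2 * s * L + s ^ 2 * Q := hex s
      have : 0 ≤ s * (2 * L + s * Q) := by nlinarith
      exact nonneg_of_mul_nonneg_right this hs
    have hQ0 : 0 ≤ Q := by
      have := hall 1 one_pos le_rfl
      linarith
    have h3 := hall (min 1 (-L / (Q + 1))) (lt_min one_pos (div_pos (by linarith) (by linarith)))
      (min_le_left _ _)
    have h4 : min 1 (-L / (Q + 1)) * Q ≤ -L / (Q + 1) * (Q + 1) := by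
      apply mul_le_mul (min_le_right _ _) (by linarith) hQ0
      exact (div_pos (by linarith) (by linarith)).le
    rw [div_mul_cancel₀ _ (by linarith)] at h4
    linarith
  have hz : ∀ᵐ p ∂(μ.prod ν), (a p.1 - b p.2) * (δ p * g p) = 0 := by
    have h0 : ∫ p, -((a p.1 - b p.2) * (δ p * g p)) ∂(μ.prod ν) = 0 := by
      apply le_antisymm
      · rw [integral_neg]; linarith
      · exact integral_nonneg fun p => by
          have := (hcases p).2.1
          simp only [Pi.zero_apply]; linarith
    have hnn : ∀ p : X × Y, 0 ≤ -((a p.1 - b p.2) * (δ p * g p)) := fun p => by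
      have := (hcases p).2.1
      linarith
    rw [integral_eq_zero_iff_of_nonneg hnn (hVL.int (μ.prod ν)).fun_neg] at h0
    filter_upwards [h0] with p hp
    simp only [Pi.zero_apply] at hp
    linarith
  have hsum : ∫ x, i₁ x * a x ∂μ + ∫ y, i₂ y * b y ∂ν ≤ μ.real E₁ + ν.real E₂ := by
    refine le_trans (le_of_eq ?_) (hb E₁ E₂ hE₁ hE₂)
    rw [VBM.fub μ ν hi₁ hθg, VBM.fub' μ ν hi₂ hθg', ← integral_add
      (((hi₁.comp measurable_fst).mul hθg).int _) (((hi₂.comp measurable_snd).mul hθg').int _),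
      ← integral_indicator (hE₁.prod hE₂)]
    apply integral_congr_ae
    filter_upwards [hz] with p hp
    rw [(hcases p).2.2 hp]
    by_cases h1 : p.1 ∈ E₁ <;> by_cases h2 : p.2 ∈ E₂ <;> simp [i₁, i₂, h1, h2, Set.indicator, Set.mem_prod]
  have hm1 : μ.real E₁ = ∫ x, i₁ x ∂μ := (integral_indicator_one hE₁).symm
  have hm2 : ν.real E₂ = ∫ y, i₂ y ∂ν := (integral_indicator_one hE₂).symm
  have hd1 : ∫ x, i₁ x * (a x - 1) ∂μ = ∫ x, i₁ x * a x ∂μ - ∫ x, i₁ x ∂μ := by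
    rw [← integral_sub ((hi₁.mul ha).int _) (hi₁.int _)]
    congr 1; ext x; ring
  have hd2 : ∫ x, i₂ x * (b x - 1) ∂ν = ∫ x, i₂ x * b x ∂ν - ∫ x, i₂ x ∂ν := by
    rw [← integral_sub ((hi₂.mul hb').int _) (hi₂.int _)]
    congr 1; ext x; ring
  have hn1 : ∀ x, 0 ≤ i₁ x * (a x - 1) := by
    intro x
    by_cases h : x ∈ E₁
    · have : 1 < a x := h
      simp only [i₁, h, Set.indicator_of_mem]; linarith
    · simp [i₁, h]
  have hn2 : ∀ x, 0 ≤ i₂ x * (b x - 1) := by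
    intro x
    by_cases h : x ∈ E₂
    · have : 1 < b x := h
      simp only [i₂, h, Set.indicator_of_mem]; linarith
    · simp [i₂, h]
  have hI1 := integral_nonneg (μ := μ) (f := fun x => i₁ x * (a x - 1)) hn1
  have hI2 := integral_nonneg (μ := ν) (f := fun x => i₂ x * (b x - 1)) hn2
  have hz1 : ∫ x, i₁ x * (a x - 1) ∂μ = 0 := by
    apply le_antisymm _ hI1
    linarith
  have hz2 : ∫ x, i₂ x * (b x - 1) ∂ν = 0 := by
    apply le_antisymm _ hI2
    linarith
  rw [integral_eq_zero_iff_of_nonneg hn1 ((hi₁.mul (ha.sub (VBM.const 1))).int _)] at hz1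
  rw [integral_eq_zero_iff_of_nonneg hn2 ((hi₂.mul (hb'.sub (VBM.const 1))).int _)] at hz2
  constructor
  · filter_upwards [hz1] with x hx
    by_contra h
    have h1 : x ∈ E₁ := not_le.1 h
    have h2 : 1 < a x := h1
    simp only [i₁, h1, Set.indicator_of_mem, Pi.zero_apply] at hx
    linarith
  · filter_upwards [hz2] with x hx
    by_contra h
    have h1 : x ∈ E₂ := not_le.1 h
    have h2 : 1 < b x := h1
    simp only [i₂, h1, Set.indicator_of_mem, Pi.zero_apply] at hx
    linarith

end fin2

/-- One half of the bound. -/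
def vH {X Y : Type*} [MeasurableSpace X] [MeasurableSpace Y] (μ : Measure X) (ν : Measure Y)
    (h : X × Y → ℝ) : Prop := ∀ᵐ x ∂μ, ∫⁻ y, ENNReal.ofReal (h (x, y)) ∂ν ≤ 1

section half
open Filter Topology
variable {X Y : Type*} [MeasurableSpace X] [MeasurableSpace Y] {μ : Measure X}
    {ν : Measure Y}

theorem vH_fatou (h : ℕ → X × Y → ℝ) (k : X × Y → ℝ) (hm : ∀ n, Measurable (h n)) (x : X)
    (hx : ∀ᵐ y ∂ν, Tendsto (fun n => h n (x, y)) atTop (𝓝 (k (x, y))))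
    (hle : ∀ᶠ n in atTop, ∫⁻ y, ENNReal.ofReal (h n (x, y)) ∂ν ≤ 1) :
    ∫⁻ y, ENNReal.ofReal (k (x, y)) ∂ν ≤ 1 := by
  have e : ∫⁻ y, ENNReal.ofReal (k (x, y)) ∂ν
      = ∫⁻ y, liminf (fun n => ENNReal.ofReal (h n (x, y))) atTop ∂ν := by
    apply lintegral_congr_ae
    filter_upwards [hx] with y hy
    exact ((ENNReal.continuous_ofReal.tendsto _).comp hy).liminf_eq.symm
  rw [e]
  refine (lintegral_liminf_le fun n =>
    ((hm n).comp measurable_prodMk_left).ennreal_ofReal).trans ?_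
  refine (liminf_le_liminf hle).trans ?_
  simp

theorem vH_cl [SFinite μ] [SFinite ν] (h : ℕ → X × Y → ℝ) (k : X × Y → ℝ)
    (hm : ∀ n, Measurable (h n))
    (hlim : ∀ᵐ p ∂(μ.prod ν), Tendsto (fun n => h n p) atTop (𝓝 (k p)))
    (hH : ∀ n, vH μ ν (h n)) : vH μ ν k := by
  have := ae_all_iff.2 hH
  unfold vH
  filter_upwards [this, Measure.ae_ae_of_ae_prod hlim] with x hx1 hx2
  exact vH_fatou h k hm x hx2 (Eventually.of_forall hx1)

theorem vH_mid {h k l : X × Y → ℝ} (hm : Measurable h) (h0 : ∀ p, 0 ≤ h p) (k0 : ∀ p, 0 ≤ k p)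
    (hl : ∀ p, l p = (1/2 : ℝ) * (h p + k p)) (hh : vH μ ν h) (hk : vH μ ν k) : vH μ ν l := by
  unfold vH at *
  filter_upwards [hh, hk] with x hx1 hx2
  have e : ∀ y, ENNReal.ofReal (l (x, y)) = ENNReal.ofReal (1/2)
      * (ENNReal.ofReal (h (x, y)) + ENNReal.ofReal (k (x, y))) := by
    intro y
    rw [hl, ENNReal.ofReal_mul (by norm_num), ENNReal.ofReal_add (h0 _) (k0 _)]
  simp only [e]
  rw [lintegral_const_mul' _ _ ENNReal.ofReal_ne_top,
    lintegral_add_left (f := fun y => ENNReal.ofReal (h (x, y)))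
      (hm.comp measurable_prodMk_left).ennreal_ofReal]
  calc _ ≤ ENNReal.ofReal (1/2) * (1 + 1) := by gcongr
    _ = 1 := by
      rw [show (1:ℝ≥0∞) + 1 = ENNReal.ofReal 2 by norm_num, ← ENNReal.ofReal_mul (by norm_num)]
      norm_num

theorem vH_mono {μ' : Measure X} {ν' : Measure Y} (hμ : μ ≤ μ') (hν : ν ≤ ν') {h k : X × Y → ℝ}
    (hhk : ∀ p, h p ≤ k p) (hk : vH μ' ν' k) : vH μ ν h := by
  unfold vH at *
  filter_upwards [(Measure.absolutelyContinuous_of_le hμ).ae_le hk] with x hx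
  refine le_trans ?_ hx
  exact lintegral_mono' hν fun y => ENNReal.ofReal_le_ofReal (hhk _)

theorem vH_lim [SigmaFinite μ] [SigmaFinite ν] (t G : X × Y → ℝ) (hmt : Measurable t)
    (hm : Measurable G)
    (hH : ∀ n : ℕ, vH (μ.restrict (spanningSets μ n)) (ν.restrict (spanningSets ν n))
      (fun p => t p * min (G p) n)) : vH μ ν (fun p => t p * G p) := by
  have h1 : ∀ n : ℕ, ∀ᵐ x ∂μ, x ∈ spanningSets μ n →
      ∫⁻ y in spanningSets ν n, ENNReal.ofReal (t (x, y) * min (G (x, y)) n) ∂ν ≤ 1 := fun n =>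
    (ae_restrict_iff' (measurableSet_spanningSets μ n)).1 (hH n)
  unfold vH
  filter_upwards [ae_all_iff.2 h1] with x hx
  refine vH_fatou (fun n p => (spanningSets ν n).indicator (fun _ => (1:ℝ)) p.2 * (t p * min (G p) n))
    (fun p => t p * G p) ?_ x ?_ ?_
  · intro n
    have := ((VBM.ind (measurableSet_spanningSets ν n)).comp (measurable_snd (α := X))).1
    exact this.mul (hmt.mul (hm.min measurable_const))
  · refine Eventually.of_forall fun y => tendsto_const_nhds.congr' ?_
    obtain ⟨N, hN⟩ := exists_nat_ge (G (x, y))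
    filter_upwards [eventually_ge_atTop N, eventually_ge_atTop (spanningSetsIndex ν y)] with n hn1 hn2
    have hy : y ∈ spanningSets ν n := mem_spanningSets_of_index_le ν y hn2
    have hn : G (x, y) ≤ n := hN.trans (by exact_mod_cast hn1)
    simp [hy, min_eq_left hn]
  · filter_upwards [eventually_ge_atTop (spanningSetsIndex μ x)] with n hn
    have := hx n (mem_spanningSets_of_index_le μ x hn)
    refine le_trans (le_of_eq ?_) this
    rw [← lintegral_indicator (measurableSet_spanningSets ν n)]
    congr 1
    ext y
    by_cases hy : y ∈ spanningSets ν n <;> simp [hy]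

theorem vH_of_integral [IsFiniteMeasure ν] {h : X × Y → ℝ} (hh : VBM h) (h0 : ∀ p, 0 ≤ h p)
    (hi : ∀ᵐ x ∂μ, ∫ y, h (x, y) ∂ν ≤ 1) : vH μ ν h := by
  unfold vH
  filter_upwards [hi] with x hx
  rw [← ofReal_integral_eq_lintegral_ofReal ((hh.comp measurable_prodMk_left).int ν)
    (Eventually.of_forall fun y => h0 _)]
  exact ENNReal.ofReal_le_one.2 hx

end half

open Filter Topology in
theorem v_main {Ω₁ Ω₂ : Type*} [MeasurableSpace Ω₁] [MeasurableSpace Ω₂]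
    (μ₁ : Measure Ω₁) (μ₂ : Measure Ω₂) [SigmaFinite μ₁] [SigmaFinite μ₂]
    (G : Ω₁ × Ω₂ → ℝ) (hG : Measurable G) (hG0 : ∀ p, 0 ≤ G p)
    (hbound : ∀ (E₁ : Set Ω₁) (E₂ : Set Ω₂), MeasurableSet E₁ → MeasurableSet E₂ →
      μ₁ E₁ < ∞ → μ₂ E₂ < ∞ →
      ∫⁻ x in E₁ ×ˢ E₂, ENNReal.ofReal (G x) ∂(μ₁.prod μ₂) ≤ μ₁ E₁ + μ₂ E₂) :
    ∃ θ : Ω₁ × Ω₂ → ℝ, Measurable θ ∧ (∀ p, 0 ≤ θ p ∧ θ p ≤ 1) ∧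
      vH μ₁ μ₂ (fun p => θ p * G p) ∧ vH μ₂ μ₁ (fun q => (1 - θ q.swap) * G q.swap) := by
  obtain ⟨θ, hθ⟩ := vW_lemma (μ₁.prod μ₂)
    (fun n => {θ | Measurable θ ∧ (∀ p, 0 ≤ θ p ∧ θ p ≤ 1) ∧
      vH (μ₁.restrict (spanningSets μ₁ n)) (μ₂.restrict (spanningSets μ₂ n))
        (fun p => θ p * min (G p) n) ∧
      vH (μ₂.restrict (spanningSets μ₂ n)) (μ₁.restrict (spanningSets μ₁ n))
        (fun q => (1 - θ q.swap) * min (G q.swap) n)})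
    (fun n η h => ⟨h.1, h.2.1⟩)
    (by
      rintro n m hnm η ⟨h1, h2, h3, h4⟩
      have a1 := Measure.restrict_mono (monotone_spanningSets μ₁ hnm) (le_refl μ₁)
      have a2 := Measure.restrict_mono (monotone_spanningSets μ₂ hnm) (le_refl μ₂)
      have hnm' : (n:ℝ) ≤ m := by exact_mod_cast hnm
      refine ⟨h1, h2, vH_mono a1 a2 (fun p => ?_) h3, vH_mono a2 a1 (fun p => ?_) h4⟩
      · exact mul_le_mul_of_nonneg_left (min_le_min le_rfl hnm') (h2 p).1
      · exact mul_le_mul_of_nonneg_left (min_le_min le_rfl hnm') (by linarith [(h2 p.swap).2]))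
    (by
      rintro n θ ⟨h1, h2, h3, h4⟩ η ⟨k1, k2, k3, k4⟩
      have hn : ∀ p, 0 ≤ min (G p) (n:ℝ) := fun p => le_min (hG0 p) (Nat.cast_nonneg n)
      refine ⟨by fun_prop, fun p => ?_, ?_, ?_⟩
      · have := h2 p
        have := k2 p
        constructor <;> linarith
      · refine vH_mid (by fun_prop) (fun p => mul_nonneg (h2 p).1 (hn p))
          (fun p => mul_nonneg (k2 p).1 (hn p)) (fun p => ?_) h3 k3
        ring
      · refine vH_mid (by fun_prop) (fun p => mul_nonneg (by linarith [(h2 p.swap).2]) (hn p.swap))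
          (fun p => mul_nonneg (by linarith [(k2 p.swap).2]) (hn p.swap)) (fun p => ?_) h4 k4
        ring)
    (by
      intro n u θ hu h1 h2 hl
      have hum := fun k => (hu k).1
      have hl' : ∀ᵐ p ∂((μ₁.restrict (spanningSets μ₁ n)).prod (μ₂.restrict (spanningSets μ₂ n))),
          Tendsto (fun k => u k p) atTop (𝓝 (θ p)) := by
        rw [Measure.prod_restrict]
        exact ae_restrict_of_ae hl
      have hl2 : ∀ᵐ p ∂((μ₂.restrict (spanningSets μ₂ n)).prod (μ₁.restrict (spanningSets μ₁ n))),
          Tendsto (fun k => u k p.swap) atTop (𝓝 (θ p.swap)) := by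
        rw [← Measure.prod_swap] at hl'
        exact ae_of_ae_map measurable_swap.aemeasurable hl'
      refine ⟨h1, h2, ?_, ?_⟩
      · refine vH_cl (fun k p => u k p * min (G p) n) _ (fun k => ?_) ?_ (fun k => (hu k).2.2.1)
        · have := hum k
          fun_prop
        · filter_upwards [hl'] with p hp
          exact hp.mul_const _
      · refine vH_cl (fun k p => (1 - u k p.swap) * min (G p.swap) n) _ (fun k => ?_) ?_
          (fun k => (hu k).2.2.2)
        · have := hum k
          fun_prop
        · filter_upwards [hl2] with p hp
          exact (hp.const_sub 1).mul_const _)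
    (by
      intro n
      have f1 : IsFiniteMeasure (μ₁.restrict (spanningSets μ₁ n)) :=
        ⟨by simpa using measure_spanningSets_lt_top μ₁ n⟩
      have f2 : IsFiniteMeasure (μ₂.restrict (spanningSets μ₂ n)) :=
        ⟨by simpa using measure_spanningSets_lt_top μ₂ n⟩
      have hn : ∀ p, 0 ≤ min (G p) (n:ℝ) := fun p => le_min (hG0 p) (Nat.cast_nonneg n)
      have hg : VBM (fun p => min (G p) (n:ℝ)) := ⟨by fun_prop, n, fun p => by
        rw [abs_of_nonneg (hn p)]; exact min_le_right _ _⟩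
      obtain ⟨θ, h1, h2, h3, h4⟩ := v_fin (μ := μ₁.restrict (spanningSets μ₁ n))
        (ν := μ₂.restrict (spanningSets μ₂ n)) hg hn (by
          intro E₁ E₂ hE₁ hE₂
          have hS := measurableSet_spanningSets μ₁ n
          have hT := measurableSet_spanningSets μ₂ n
          have k1 : μ₁ (E₁ ∩ spanningSets μ₁ n) < ∞ :=
            (measure_mono Set.inter_subset_right).trans_lt (measure_spanningSets_lt_top μ₁ n)
          have k2 : μ₂ (E₂ ∩ spanningSets μ₂ n) < ∞ :=
            (measure_mono Set.inter_subset_right).trans_lt (measure_spanningSets_lt_top μ₂ n)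
          have hb := hbound _ _ (hE₁.inter hS) (hE₂.inter hT) k1 k2
          rw [integral_eq_lintegral_of_nonneg_ae (Eventually.of_forall hn)
            hg.1.aestronglyMeasurable, measureReal_def, measureReal_def,
            Measure.restrict_apply hE₁, Measure.restrict_apply hE₂,
            ← ENNReal.toReal_add k1.ne k2.ne]
          apply ENNReal.toReal_mono (ENNReal.add_lt_top.2 ⟨k1, k2⟩).ne
          refine le_trans ?_ hb
          rw [Measure.prod_restrict, Measure.restrict_restrict (hE₁.prod hE₂), Set.prod_inter_prod]
          exact lintegral_mono fun p => ENNReal.ofReal_le_ofReal (min_le_left _ _))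
      have hθ := VBM.unit h1 h2
      refine ⟨θ, h1, h2, vH_of_integral (hθ.mul hg) (fun p => mul_nonneg (h2 p).1 (hn p)) h3, ?_⟩
      exact vH_of_integral ((((VBM.const 1).sub hθ).mul hg).comp measurable_swap)
        (fun p => mul_nonneg (by linarith [(h2 p.swap).2]) (hn p.swap)) h4)
  have hm := (hθ 0).1
  refine ⟨θ, hm, (hθ 0).2.1, vH_lim θ G hm hG fun n => (hθ n).2.2.1, ?_⟩
  exact vH_lim (fun q => 1 - θ q.swap) (fun q => G q.swap) (by fun_prop) (by fun_prop)
    fun n => (hθ n).2.2.2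

/-- Varopoulos' lemma, converse with constant 2: if for all measurable sets `E₁, E₂` of finite
measure one has `∫_{E₁×E₂} |f| ≤ μ₁ E₁ + μ₂ E₂`, then `f` decomposes as `f = f₁ + f₂` a.e. with
`‖f₁‖_{L_∞(μ₁;L_1(μ₂))} + ‖f₂‖_{L_∞(μ₂;L_1(μ₁))} ≤ 2`. -/
theorem varopoulos_converse
    {Ω₁ Ω₂ : Type*} [MeasurableSpace Ω₁] [MeasurableSpace Ω₂]
    (μ₁ : Measure Ω₁) (μ₂ : Measure Ω₂) [SigmaFinite μ₁] [SigmaFinite μ₂]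
    (f : Ω₁ × Ω₂ → ℝ) (hf : Measurable f)
    (hbound : ∀ E₁ E₂ : Set _, MeasurableSet E₁ → MeasurableSet E₂ →
      μ₁ E₁ < ∞ → μ₂ E₂ < ∞ →
      ∫⁻ x in E₁ ×ˢ E₂, ‖f x‖₊ ∂(μ₁.prod μ₂) ≤ μ₁ E₁ + μ₂ E₂) :
    ∃ f₁ f₂ : Ω₁ × Ω₂ → ℝ, Measurable f₁ ∧ Measurable f₂ ∧
      f =ᵐ[μ₁.prod μ₂] f₁ + f₂ ∧
      essSup (fun ω₁ => ∫⁻ ω₂, ‖f₁ (ω₁, ω₂)‖₊ ∂μ₂) μ₁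
        + essSup (fun ω₂ => ∫⁻ ω₁, ‖f₂ (ω₁, ω₂)‖₊ ∂μ₁) μ₂ ≤ 2 := by
  have e : ∀ t : ℝ, ((‖t‖₊ : ℝ≥0∞)) = ENNReal.ofReal |t| := fun t => by
    rw [← Real.norm_eq_abs, ofReal_norm]; rfl
  simp only [e] at hbound ⊢
  obtain ⟨θ, hm, h01, h1, h2⟩ := v_main μ₁ μ₂ (fun p => |f p|) (by fun_prop) (fun p => abs_nonneg _)
    hbound
  refine ⟨fun p => θ p * f p, fun p => (1 - θ p) * f p, by fun_prop, by fun_prop,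
    Filter.Eventually.of_forall fun p => by simp only [Pi.add_apply]; ring, ?_⟩
  rw [← one_add_one_eq_two]
  refine add_le_add (essSup_le_of_ae_le 1 ?_) (essSup_le_of_ae_le 1 ?_)
  · filter_upwards [h1] with x hx
    simp only [abs_mul, abs_of_nonneg (h01 _).1]
    exact hx
  · filter_upwards [h2] with x hx
    have h3 : ∀ p, |1 - θ p| = 1 - θ p := fun p => abs_of_nonneg (by linarith [(h01 p).2])
    simp only [abs_mul, h3]
    exact hx
end

section
/- (Main decomposition lemma.) Let 1 < p₁, p₂ < ∞ and set pⱼ' = pⱼ/(pⱼ−1). Suppose that f : Ω₁ × Ω₂ → ℝ is measurable and that for every pair of measurable sets E₁ ⊆ Ω₁ and E₂ ⊆ Ω₂ of finite measure one has ∫_{E₁×E₂} |f| d(μ₁×μ₂) ≤ μ₁(E₁)^{1/p₁'} + μ₂(E₂)^{1/p₂'}. Then there exist measurable functions f₁, f₂ with f = f₁ + f₂ (μ₁×μ₂)-almost everywhere and ‖f₁‖_{L_{p₁,∞}(μ₁;L_1(μ₂))} + ‖f₂‖_{L_{p₂,∞}(μ₂;L_1(μ₁))} ≤ 2. -/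
open MeasureTheory ENNReal

/-- The mixed weak norm `‖g‖_{L_{p,∞}(μ₁;L_1(μ₂))}`: the supremum over measurable sets
`E ⊆ Ω₁` with `0 < μ₁ E < ∞` of `μ₁(E)^{-1/p'} ∫_E (∫ |g(ω₁,ω₂)| dμ₂) dμ₁`,
where the exponent `p'` is passed directly as a real number. -/
noncomputable def mixedWeakNorm {Ω₁ Ω₂ : Type*} [MeasurableSpace Ω₁] [MeasurableSpace Ω₂]
    (μ₁ : Measure Ω₁) (μ₂ : Measure Ω₂) (p' : ℝ) (g : Ω₁ × Ω₂ → ℝ) : ℝ≥0∞ :=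
  ⨆ (E : Set Ω₁) (_ : MeasurableSet E) (_ : 0 < μ₁ E) (_ : μ₁ E < ∞),
    μ₁ E ^ (-(1 / p')) * ∫⁻ ω₁ in E, (∫⁻ ω₂, ‖g (ω₁, ω₂)‖₊ ∂μ₂) ∂μ₁

theorem aux_four_point {θ : ℝ} (h0 : 0 ≤ θ) (h1 : θ ≤ 1) {u v x y : ℝ} (hv : 0 ≤ v)
    (hvx : v ≤ x) (hvy : v ≤ y) (h : x + y = u + v) :
    u ^ θ + v ^ θ ≤ x ^ θ + y ^ θ := by
  have hc := Real.concaveOn_rpow h0 h1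
  rcases eq_or_lt_of_le (show v ≤ u by linarith) with huv | huv
  · have : x = v := by linarith
    have : y = v := by linarith
    subst_vars; exact le_rfl
  · have hd : 0 < u - v := by linarith
    have hu : 0 ≤ u := by linarith
    have e1 := hc.2 (Set.mem_Ici.2 hu) (Set.mem_Ici.2 hv) 
      (show 0 ≤ (x - v) / (u - v) from div_nonneg (by linarith) hd.le)
      (show 0 ≤ (y - v) / (u - v) from div_nonneg (by linarith) hd.le)
      (by field_simp; linarith)
    have e2 := hc.2 (Set.mem_Ici.2 hu) (Set.mem_Ici.2 hv) 
      (show 0 ≤ (y - v) / (u - v) from div_nonneg (by linarith) hd.le)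
      (show 0 ≤ (x - v) / (u - v) from div_nonneg (by linarith) hd.le)
      (by field_simp; linarith)
    simp only [smul_eq_mul] at e1 e2
    have x1 : (x - v) / (u - v) * u + (y - v) / (u - v) * v = x := by
      have : y = u + v - x := by linarith
      subst this; field_simp; ring
    have x2 : (y - v) / (u - v) * u + (x - v) / (u - v) * v = y := by
      have : y = u + v - x := by linarith
      subst this; field_simp; ring
    rw [x1] at e1
    rw [x2] at e2
    have x3 : (x - v) / (u - v) + (y - v) / (u - v) = 1 := by field_simp; linarith
    have : u ^ θ + v ^ θ = ((x - v) / (u - v) + (y - v) / (u - v)) * (u ^ θ + v ^ θ) := by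
      rw [x3, one_mul]
    rw [this]; linarith

/-- Monotone submodular normalised set functions. -/
structure AuxPoly {X : Type*} [DecidableEq X] (F : Finset X → ℝ) : Prop where
  empty : F ∅ = 0
  mono : ∀ A B, A ⊆ B → F A ≤ F B
  sub : ∀ A B, F (A ∪ B) + F (A ∩ B) ≤ F A + F B

theorem AuxPoly.reduce {X : Type*} [DecidableEq X] {F : Finset X → ℝ} (hF : AuxPoly F) (e : X)
    (s : ℝ) (hs : s ≤ F {e}) :
    AuxPoly (fun A => min (F A) (F (insert e A) - s)) where
  empty := by
    simp only [hF.empty, insert_empty_eq]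
    exact min_eq_left (by linarith)
  mono A B h := min_le_min (hF.mono _ _ h)
    (by linarith [hF.mono _ _ (Finset.insert_subset_insert e h)])
  sub A B := by
    have k1 := hF.sub A B
    have k2 := hF.sub (insert e A) (insert e B)
    have k3 := hF.sub A (insert e B)
    have k4 := hF.sub (insert e A) B
    rw [← Finset.insert_union_distrib, ← Finset.insert_inter_distrib] at k2
    rw [Finset.union_insert] at k3
    rw [Finset.insert_union] at k4
    have m3 := hF.mono (A ∩ B) (A ∩ insert e B) (by gcongr; exact Finset.subset_insert _ _)
    have m4 := hF.mono (A ∩ B) (insert e A ∩ B) (by gcongr; exact Finset.subset_insert _ _)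
    have l1 := min_le_left (F (A ∪ B)) (F (insert e (A ∪ B)) - s)
    have l2 := min_le_right (F (A ∪ B)) (F (insert e (A ∪ B)) - s)
    have l3 := min_le_left (F (A ∩ B)) (F (insert e (A ∩ B)) - s)
    have l4 := min_le_right (F (A ∩ B)) (F (insert e (A ∩ B)) - s)
    rcases min_choice (F A) (F (insert e A) - s) with h | h <;>
    rcases min_choice (F B) (F (insert e B) - s) with h' | h' <;>
    simp only [h, h'] <;> linarith

theorem aux_split {X : Type*} [DecidableEq X] (a : X → ℝ) (ha : ∀ x, 0 ≤ a x) (U : Finset X) :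
    ∀ F G : Finset X → ℝ, AuxPoly F → AuxPoly G →
      (∀ A ⊆ U, ∑ x ∈ A, a x ≤ F A + G A) →
      ∃ b : X → ℝ, (∀ x, 0 ≤ b x ∧ b x ≤ a x) ∧
        ∀ A ⊆ U, ∑ x ∈ A, b x ≤ F A ∧ ∑ x ∈ A, (a x - b x) ≤ G A := by
  induction U using Finset.induction_on with
  | empty =>
    intro F G hF hG _
    refine ⟨a, fun x => ⟨ha x, le_rfl⟩, fun A hA => ?_⟩
    rw [Finset.subset_empty.1 hA]
    simp [hF.empty, hG.empty]
  | insert e U he ih =>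
    intro F G hF hG hb
    have notin : ∀ A ⊆ U, e ∉ A := fun A hA h => he (hA h)
    obtain ⟨s, hs0, hsa, hs1, hs2⟩ : ∃ s, 0 ≤ s ∧ s ≤ a e ∧
        (∀ B ⊆ U, s ≤ F (insert e B) + G B - ∑ x ∈ B, a x) ∧
        (∀ A ⊆ U, a e - s ≤ F A + G (insert e A) - ∑ x ∈ A, a x) := by
      have hne : U.powerset.Nonempty := Finset.powerset_nonempty U
      let m := U.powerset.inf' hne (fun B => F (insert e B) + G B - ∑ x ∈ B, a x)
      have hm : ∀ B ⊆ U, m ≤ F (insert e B) + G B - ∑ x ∈ B, a x := fun B hB =>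
        Finset.inf'_le _ (Finset.mem_powerset.2 hB)
      have hm' : ∀ c, (∀ B ⊆ U, c ≤ F (insert e B) + G B - ∑ x ∈ B, a x) → c ≤ m := fun c hc =>
        Finset.le_inf' _ _ fun B hB => hc B (Finset.mem_powerset.1 hB)
      refine ⟨min m (a e), le_min (hm' _ fun B hB => ?_) (ha e), min_le_right _ _,
        fun B hB => (min_le_left _ _).trans (hm B hB), fun A hA => ?_⟩
      · have := hb B (hB.trans (Finset.subset_insert _ _))
        have := hF.mono B (insert e B) (Finset.subset_insert _ _)
        linarith
      · have hk : a e + ∑ x ∈ A, a x - F A - G (insert e A) ≤ min m (a e) := by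
          refine le_min (hm' _ fun B hB => ?_) ?_
          · have k1 := hF.sub A (insert e B)
            have k2 := hG.sub (insert e A) B
            rw [Finset.union_insert, Finset.inter_insert_of_notMem (notin A hA)] at k1
            rw [Finset.insert_union, Finset.insert_inter_of_notMem (notin B hB)] at k2
            have k3 := hb (insert e (A ∪ B)) (Finset.insert_subset_insert _ (Finset.union_subset hA hB))
            have k4 := hb (A ∩ B) ((Finset.inter_subset_left.trans hA).trans (Finset.subset_insert _ _))
            have k5 := Finset.sum_union_inter (s₁ := A) (s₂ := B) (f := a)
            rw [Finset.sum_insert (notin _ (Finset.union_subset hA hB))] at k3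
            linarith
          · have := hb A (hA.trans (Finset.subset_insert _ _))
            have := hG.mono A (insert e A) (Finset.subset_insert _ _)
            linarith
        linarith
    have hsF : s ≤ F {e} := by
      have := hs1 ∅ (Finset.empty_subset _)
      simpa [hG.empty] using this
    have hsG : a e - s ≤ G {e} := by
      have := hs2 ∅ (Finset.empty_subset _)
      simpa [hF.empty] using this
    obtain ⟨b, hb1, hb2⟩ := ih _ _ (hF.reduce e s hsF) (hG.reduce e (a e - s) hsG) (by
      intro A hA
      have k1 := hb A (hA.trans (Finset.subset_insert _ _))
      have k2 := hb (insert e A) (Finset.insert_subset_insert _ hA)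
      rw [Finset.sum_insert (notin A hA)] at k2
      have k3 := hs1 A hA
      have k4 := hs2 A hA
      rcases min_choice (F A) (F (insert e A) - s) with h | h <;>
      rcases min_choice (G A) (G (insert e A) - (a e - s)) with h' | h' <;>
      simp only [h, h'] <;> linarith)
    refine ⟨Function.update b e s, fun x => ?_, fun A hA => ?_⟩
    · by_cases hx : x = e
      · subst hx; simp [hs0, hsa]
      · simp [hx, hb1 x]
    · have key : ∀ B ⊆ U, ∑ x ∈ B, Function.update b e s x = ∑ x ∈ B, b x ∧
          ∑ x ∈ B, (a x - Function.update b e s x) = ∑ x ∈ B, (a x - b x) := by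
        intro B hB
        have : ∀ x ∈ B, Function.update b e s x = b x := fun x hx =>
          Function.update_of_ne (by rintro rfl; exact notin B hB hx) _ _
        exact ⟨Finset.sum_congr rfl this, Finset.sum_congr rfl fun x hx => by rw [this x hx]⟩
      by_cases heA : e ∈ A
      · obtain ⟨B, hB, rfl⟩ : ∃ B ⊆ U, A = insert e B :=
          ⟨A.erase e, Finset.subset_insert_iff.1 hA, (Finset.insert_erase heA).symm⟩
        have := hb2 B hB
        rw [Finset.sum_insert (notin B hB), Finset.sum_insert (notin B hB), (key B hB).1,
          (key B hB).2]
        have l1 := min_le_right (F B) (F (insert e B) - s)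
        have l2 := min_le_right (G B) (G (insert e B) - (a e - s))
        simp only [Function.update_self]
        constructor <;> linarith
      · have hA' : A ⊆ U := (Finset.subset_insert_iff_of_notMem heA).1 hA
        have := hb2 A hA'
        rw [(key A hA').1, (key A hA').2]
        exact ⟨this.1.trans (min_le_left _ _), this.2.trans (min_le_left _ _)⟩

theorem aux_poly_measure {Ω ι X : Type*} [MeasurableSpace Ω] [Finite ι] [MeasurableSpace ι]
    [MeasurableSingletonClass ι] [DecidableEq X] [DecidableEq ι]
    (μ : Measure Ω) [IsFiniteMeasure μ] (pr : X → ι) (π : Ω → ι) (hπ : Measurable π)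
    (θ : ℝ) (h0 : 0 < θ) (h1 : θ ≤ 1) :
    AuxPoly (fun A : Finset X => (μ.real (π ⁻¹' (A.image pr : Finset ι))) ^ θ) where
  empty := by simp [h0.ne']
  mono A B h := by
    refine Real.rpow_le_rpow measureReal_nonneg (measureReal_mono ?_) h0.le
    refine Set.preimage_mono ?_
    exact_mod_cast Finset.image_subset_image h
  sub A B := by
    have hm : ∀ S : Set ι, MeasurableSet (π ⁻¹' S) := fun S => hπ (Set.toFinite S).measurableSet
    have h2 : μ.real (π ⁻¹' ((A ∩ B).image pr : Finset ι)) ≤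
        μ.real ((π ⁻¹' (A.image pr : Finset ι)) ∩ (π ⁻¹' (B.image pr : Finset ι))) := by
      refine measureReal_mono ?_
      rw [← Set.preimage_inter]
      refine Set.preimage_mono ?_
      exact_mod_cast Finset.image_inter_subset pr A B
    have h3 := aux_four_point h0.le h1 (v := μ.real ((π ⁻¹' (A.image pr : Finset ι)) ∩
      (π ⁻¹' (B.image pr : Finset ι)))) measureReal_nonneg
      (measureReal_mono Set.inter_subset_left) (measureReal_mono Set.inter_subset_right)
      (measureReal_union_add_inter (μ := μ) (s := π ⁻¹' (A.image pr : Finset ι))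
       (hm (B.image pr : Finset ι))).symm
    have h4 := Real.rpow_le_rpow measureReal_nonneg h2 h0.le
    rw [Finset.image_union, Finset.coe_union, Set.preimage_union]
    linarith

theorem aux_finite {Ω₁ Ω₂ K : Type*} [MeasurableSpace Ω₁] [MeasurableSpace Ω₂] [Finite K]
    (μ₁ : Measure Ω₁) (μ₂ : Measure Ω₂) [IsFiniteMeasure μ₁] [IsFiniteMeasure μ₂]
    (ν : Measure (Ω₁ × Ω₂)) (θ₁ θ₂ : ℝ) (h01 : 0 < θ₁) (h11 : θ₁ ≤ 1) (h02 : 0 < θ₂)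
    (h12 : θ₂ ≤ 1)
    (hν : ∀ (E₁ : Set Ω₁) (E₂ : Set Ω₂), MeasurableSet E₁ → MeasurableSet E₂ →
      ν (E₁ ×ˢ E₂) ≤ μ₁ E₁ ^ θ₁ + μ₂ E₂ ^ θ₂)
    (E : K → Set Ω₁) (G : K → Set Ω₂) (hE : ∀ k, MeasurableSet (E k))
    (hG : ∀ k, MeasurableSet (G k)) :
    ∃ h : Ω₁ × Ω₂ → ℝ, Measurable h ∧ (∀ x, 0 ≤ h x ∧ h x ≤ 1) ∧
      ∀ k, ∫⁻ x in E k ×ˢ G k, ENNReal.ofReal (h x) ∂ν ≤ μ₁ (E k) ^ θ₁ ∧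
        ∫⁻ x in E k ×ˢ G k, ENNReal.ofReal (1 - h x) ∂ν ≤ μ₂ (G k) ^ θ₂ := by
  classical
  have : Fintype K := Fintype.ofFinite K
  let π₁ : Ω₁ → (K → Prop) := fun ω k => ω ∈ E k
  let π₂ : Ω₂ → (K → Prop) := fun ω k => ω ∈ G k
  have hπ₁ : Measurable π₁ := measurable_pi_lambda _ fun k => measurable_mem.2 (hE k)
  have hπ₂ : Measurable π₂ := measurable_pi_lambda _ fun k => measurable_mem.2 (hG k)
  let π : Ω₁ × Ω₂ → (K → Prop) × (K → Prop) := Prod.map π₁ π₂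
  have hπ : Measurable π := hπ₁.prodMap hπ₂
  have hfin : IsFiniteMeasure ν := ⟨by
    have := hν Set.univ Set.univ .univ .univ
    rw [Set.univ_prod_univ] at this
    refine this.trans_lt (ENNReal.add_lt_top.2 ⟨?_, ?_⟩)
    · exact ENNReal.rpow_lt_top_of_nonneg h01.le (measure_ne_top _ _)
    · exact ENNReal.rpow_lt_top_of_nonneg h02.le (measure_ne_top _ _)⟩
  let a : (K → Prop) × (K → Prop) → ℝ := fun x => ν.real (π ⁻¹' {x})
  have hsum : ∀ A : Finset ((K → Prop) × (K → Prop)), ∑ x ∈ A, a x = ν.real (π ⁻¹' A) := by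
    intro A
    simp only [a]
    exact sum_measureReal_preimage_singleton A (fun y _ => hπ (measurableSet_singleton y))
  obtain ⟨b, hb, hb'⟩ := aux_split a (fun x => measureReal_nonneg) Finset.univ _ _
    (aux_poly_measure μ₁ Prod.fst π₁ hπ₁ θ₁ h01 h11)
    (aux_poly_measure μ₂ Prod.snd π₂ hπ₂ θ₂ h02 h12) (by
      intro A _
      rw [hsum]
      have k1 := hν (π₁ ⁻¹' (A.image Prod.fst : Finset (K → Prop)))
        (π₂ ⁻¹' (A.image Prod.snd : Finset (K → Prop)))
        (hπ₁ (Finset.measurableSet _)) (hπ₂ (Finset.measurableSet _))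
      have k2 : ν (π ⁻¹' A) ≤ _ := (measure_mono (fun x hx => by
        simp only [Set.mem_preimage, Finset.mem_coe] at hx
        exact ⟨Finset.mem_coe.2 (Finset.mem_image_of_mem Prod.fst hx),
          Finset.mem_coe.2 (Finset.mem_image_of_mem Prod.snd hx)⟩)).trans k1
      have t1 := ENNReal.rpow_ne_top_of_nonneg h01.le
        (measure_ne_top μ₁ (π₁ ⁻¹' (A.image Prod.fst : Finset (K → Prop))))
      have t2 := ENNReal.rpow_ne_top_of_nonneg h02.le
        (measure_ne_top μ₂ (π₂ ⁻¹' (A.image Prod.snd : Finset (K → Prop))))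
      have := ENNReal.toReal_mono (ENNReal.add_ne_top.2 ⟨t1, t2⟩) k2
      rw [ENNReal.toReal_add t1 t2, ← ENNReal.toReal_rpow, ← ENNReal.toReal_rpow] at this
      exact this)
  have hint : ∀ (A : Finset ((K → Prop) × (K → Prop))) (c : (K → Prop) × (K → Prop) → ℝ),
      (∀ x, 0 ≤ c x) →
      ∫⁻ x in π ⁻¹' A, ENNReal.ofReal (c (π x)) ∂ν = ENNReal.ofReal (∑ x ∈ A, c x * a x) := by
    intro A c hc
    have e1 : π ⁻¹' (A : Set ((K → Prop) × (K → Prop))) = ⋃ x ∈ A, π ⁻¹' {x} := by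
      ext y; simp
    rw [e1, lintegral_biUnion_finset, ENNReal.ofReal_sum_of_nonneg]
    · refine Finset.sum_congr rfl fun x _ => ?_
      rw [setLIntegral_congr_fun (g := fun _ => ENNReal.ofReal (c x))
        (hπ (measurableSet_singleton x)) (fun y hy => by
          have hy' : π y = x := hy
          simp only [hy'])]
      rw [setLIntegral_const, ENNReal.ofReal_mul (hc x), ofReal_measureReal]
    · exact fun x _ => mul_nonneg (hc x) measureReal_nonneg
    · intro x _ y _ hxy
      exact Disjoint.preimage _ (Set.disjoint_singleton.2 hxy)
    · exact fun x _ => hπ (measurableSet_singleton x)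
  have hmul : ∀ x, b x / a x * a x = b x := by
    intro x
    by_cases hx : a x = 0
    · have := hb x
      rw [hx] at this ⊢
      rw [mul_zero]; linarith
    · exact div_mul_cancel₀ _ hx
  have h01' : ∀ x, 0 ≤ b x / a x ∧ b x / a x ≤ 1 := fun x =>
    ⟨div_nonneg (hb x).1 measureReal_nonneg, div_le_one_of_le₀ (hb x).2 measureReal_nonneg⟩
  refine ⟨fun x => b (π x) / a (π x), ?_, fun x => h01' _, fun k => ?_⟩
  · exact (measurable_of_finite (fun y => b y / a y)).comp hπ
  · let A : Finset ((K → Prop) × (K → Prop)) := Finset.univ.filter fun x => x.1 k ∧ x.2 k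
    have hA : E k ×ˢ G k = π ⁻¹' (A : Set ((K → Prop) × (K → Prop))) := by
      ext x; simp [A, π, π₁, π₂]
    have hA1 : π₁ ⁻¹' (A.image Prod.fst : Finset (K → Prop)) ⊆ E k := by
      intro x hx
      simp only [Finset.coe_image, Set.mem_preimage, Set.mem_image, Finset.mem_coe] at hx
      obtain ⟨y, hy, hy2⟩ := hx
      have := (Finset.mem_filter.1 hy).2.1
      rw [hy2] at this
      exact this
    have hA2 : π₂ ⁻¹' (A.image Prod.snd : Finset (K → Prop)) ⊆ G k := by
      intro x hx
      simp only [Finset.coe_image, Set.mem_preimage, Set.mem_image, Finset.mem_coe] at hx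
      obtain ⟨y, hy, hy2⟩ := hx
      have := (Finset.mem_filter.1 hy).2.2
      rw [hy2] at this
      exact this
    have hk := hb' A (Finset.subset_univ _)
    rw [hA]
    constructor
    · rw [hint A (fun x => b x / a x) (fun x => (h01' x).1)]
      simp only [hmul]
      refine (ENNReal.ofReal_le_ofReal hk.1).trans ?_
      rw [← ENNReal.ofReal_rpow_of_nonneg measureReal_nonneg h01.le, ofReal_measureReal]
      gcongr
    · rw [hint A (fun x => 1 - b x / a x) (fun x => sub_nonneg.2 (h01' x).2)]
      simp only [sub_mul, hmul, one_mul]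
      refine (ENNReal.ofReal_le_ofReal hk.2).trans ?_
      rw [← ENNReal.ofReal_rpow_of_nonneg measureReal_nonneg h02.le, ofReal_measureReal]
      gcongr

theorem aux_finite' {Ω₁ Ω₂ K : Type*} [MeasurableSpace Ω₁] [MeasurableSpace Ω₂] [Finite K]
    (μ₁ : Measure Ω₁) (μ₂ : Measure Ω₂)
    (ν : Measure (Ω₁ × Ω₂)) (θ₁ θ₂ : ℝ) (h01 : 0 < θ₁) (h11 : θ₁ ≤ 1) (h02 : 0 < θ₂)
    (h12 : θ₂ ≤ 1)
    (hν : ∀ (E₁ : Set Ω₁) (E₂ : Set Ω₂), MeasurableSet E₁ → MeasurableSet E₂ →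
      μ₁ E₁ < ∞ → μ₂ E₂ < ∞ → ν (E₁ ×ˢ E₂) ≤ μ₁ E₁ ^ θ₁ + μ₂ E₂ ^ θ₂)
    (E : K → Set Ω₁) (G : K → Set Ω₂) (hE : ∀ k, MeasurableSet (E k))
    (hG : ∀ k, MeasurableSet (G k)) (hE' : ∀ k, μ₁ (E k) < ∞) (hG' : ∀ k, μ₂ (G k) < ∞) :
    ∃ h : Ω₁ × Ω₂ → ℝ, Measurable h ∧ (∀ x, 0 ≤ h x ∧ h x ≤ 1) ∧
      ∀ k, ∫⁻ x in E k ×ˢ G k, ENNReal.ofReal (h x) ∂ν ≤ μ₁ (E k) ^ θ₁ ∧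
        ∫⁻ x in E k ×ˢ G k, ENNReal.ofReal (1 - h x) ∂ν ≤ μ₂ (G k) ^ θ₂ := by
  have : Fintype K := Fintype.ofFinite K
  have hU : MeasurableSet (⋃ k, E k) := .iUnion hE
  have hV : MeasurableSet (⋃ k, G k) := .iUnion hG
  have fU : μ₁ (⋃ k, E k) < ∞ :=
    (measure_iUnion_fintype_le _ _).trans_lt (ENNReal.sum_lt_top.2 fun k _ => hE' k)
  have fV : μ₂ (⋃ k, G k) < ∞ :=
    (measure_iUnion_fintype_le _ _).trans_lt (ENNReal.sum_lt_top.2 fun k _ => hG' k)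
  have : IsFiniteMeasure (μ₁.restrict (⋃ k, E k)) := ⟨by simpa using fU⟩
  have : IsFiniteMeasure (μ₂.restrict (⋃ k, G k)) := ⟨by simpa using fV⟩
  obtain ⟨h, hm, hb, hh⟩ := aux_finite (μ₁.restrict (⋃ k, E k)) (μ₂.restrict (⋃ k, G k))
    (ν.restrict ((⋃ k, E k) ×ˢ (⋃ k, G k))) θ₁ θ₂ h01 h11 h02 h12 (by
      intro E₁ E₂ m1 m2
      rw [Measure.restrict_apply (m1.prod m2), Measure.restrict_apply m1, Measure.restrict_apply m2,
        Set.prod_inter_prod]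
      exact hν _ _ (m1.inter hU) (m2.inter hV) ((measure_mono Set.inter_subset_right).trans_lt fU)
        ((measure_mono Set.inter_subset_right).trans_lt fV)) E G hE hG
  refine ⟨h, hm, hb, fun k => ?_⟩
  have := hh k
  rw [Measure.restrict_restrict ((hE k).prod (hG k)), Set.prod_inter_prod,
    Set.inter_eq_left.2 (Set.subset_iUnion E k), Set.inter_eq_left.2 (Set.subset_iUnion G k),
    Measure.restrict_apply (hE k), Measure.restrict_apply (hG k),
    Set.inter_eq_left.2 (Set.subset_iUnion E k), Set.inter_eq_left.2 (Set.subset_iUnion G k)] at this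
  exact this

theorem aux_compact {Ω ι : Type*} [MeasurableSpace Ω] (ρ : Measure Ω) [IsFiniteMeasure ρ]
    (v : ι → Ω → ℝ) (hv : ∀ i, MemLp (v i) 2 ρ) (l c : ι → ℝ)
    (H : ∀ u : Finset ι, ∃ h : Ω → ℝ, Measurable h ∧ (∀ x, 0 ≤ h x ∧ h x ≤ 1) ∧
      ∀ i ∈ u, l i ≤ ∫ x, h x * v i x ∂ρ ∧ ∫ x, h x * v i x ∂ρ ≤ c i) :
    ∃ h : Ω → ℝ, Measurable h ∧ (∀ x, 0 ≤ h x ∧ h x ≤ 1) ∧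
      ∀ i, l i ≤ ∫ x, h x * v i x ∂ρ ∧ ∫ x, h x * v i x ∂ρ ≤ c i := by
  let one : Lp ℝ 2 ρ := (memLp_const (1 : ℝ)).toLp (fun _ : Ω => (1 : ℝ))
  let ind : {s : Set Ω // MeasurableSet s} → Lp ℝ 2 ρ := fun s =>
    indicatorConstLp 2 s.2 (measure_ne_top ρ s.1) (1 : ℝ)
  let V : ι → Lp ℝ 2 ρ := fun i => (hv i).toLp (v i)
  let B : Set (WeakDual ℝ (Lp ℝ 2 ρ)) := WeakDual.toStrongDual ⁻¹' Metric.closedBall 0 ‖one‖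
  let C : Set (WeakDual ℝ (Lp ℝ 2 ρ)) := ⋂ s, {ℓ | 0 ≤ ℓ (ind s) ∧ ℓ (ind s) ≤ ρ.real s.1}
  let T : ι → Set (WeakDual ℝ (Lp ℝ 2 ρ)) := fun i => {ℓ | l i ≤ ℓ (V i) ∧ ℓ (V i) ≤ c i}
  have hB : IsCompact B := WeakDual.isCompact_closedBall 0 _
  have hclosed : ∀ (w : Lp ℝ 2 ρ) (a b : ℝ),
      IsClosed {ℓ : WeakDual ℝ (Lp ℝ 2 ρ) | a ≤ ℓ w ∧ ℓ w ≤ b} := fun w a b =>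
    (isClosed_le continuous_const (WeakDual.eval_continuous w)).inter
      (isClosed_le (WeakDual.eval_continuous w) continuous_const)
  have hC : IsClosed C := isClosed_iInter fun s => hclosed _ _ _
  have hne := (hB.inter_right hC).inter_iInter_nonempty T (fun i => hclosed _ _ _) (by
    intro u
    obtain ⟨h, hm, hb, hh⟩ := H u
    have hL : MemLp h 2 ρ := MemLp.of_bound hm.aestronglyMeasurable 1
      (ae_of_all _ fun x => by rw [Real.norm_of_nonneg (hb x).1]; exact (hb x).2)
    let L : Lp ℝ 2 ρ := hL.toLp h
    have hLe : L =ᵐ[ρ] h := hL.coeFn_toLp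
    let ℓ : WeakDual ℝ (Lp ℝ 2 ρ) := StrongDual.toWeakDual (InnerProductSpace.toDual ℝ _ L)
    have hℓ : ∀ w, ℓ w = inner ℝ L w := fun w => rfl
    refine ⟨ℓ, ⟨?_, ?_⟩, ?_⟩
    · show InnerProductSpace.toDual ℝ _ L ∈ Metric.closedBall 0 ‖one‖
      rw [mem_closedBall_zero_iff, LinearIsometryEquiv.norm_map]
      refine Lp.norm_le_norm_of_ae_le ?_
      filter_upwards [hLe, (memLp_const (μ := ρ) (p := 2) (1 : ℝ)).coeFn_toLp] with x h1 h2
      rw [h1, h2, Real.norm_of_nonneg (hb x).1, norm_one]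
      exact (hb x).2
    · refine Set.mem_iInter.2 fun s => ?_
      have e : ℓ (ind s) = ∫ x in s.1, h x ∂ρ := by
        rw [hℓ, real_inner_comm, L2.inner_indicatorConstLp_one]
        exact integral_congr_ae (ae_restrict_of_ae hLe)
      show 0 ≤ ℓ (ind s) ∧ ℓ (ind s) ≤ ρ.real s.1
      rw [e]
      refine ⟨integral_nonneg fun x => (hb x).1, ?_⟩
      have : ∫ x in s.1, h x ∂ρ ≤ ∫ x in s.1, (1 : ℝ) ∂ρ :=
        integral_mono (hL.integrable (by norm_num)).integrableOn (integrable_const _)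
          fun x => (hb x).2
      simpa using this
    · refine Set.mem_iInter₂.2 fun i hi => ?_
      have e : ℓ (V i) = ∫ x, h x * v i x ∂ρ := by
        rw [hℓ, L2.inner_def]
        refine integral_congr_ae ?_
        filter_upwards [hLe, (hv i).coeFn_toLp] with x h1 h2
        simp only [V, h1, h2, RCLike.inner_apply, conj_trivial]
        ring
      show l i ≤ ℓ (V i) ∧ ℓ (V i) ≤ c i
      rw [e]
      exact hh i hi)
  obtain ⟨ℓ, ⟨-, hℓC⟩, hℓT⟩ := hne
  let L : Lp ℝ 2 ρ := (InnerProductSpace.toDual ℝ _).symm (WeakDual.toStrongDual ℓ)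
  have hℓ : ∀ w, ℓ w = inner ℝ L w := fun w =>
    (InnerProductSpace.toDual_symm_apply (𝕜 := ℝ) (x := w) (y := WeakDual.toStrongDual ℓ)).symm
  have hLi : Integrable L ρ := (Lp.memLp L).integrable (by norm_num)
  have hs : ∀ s, MeasurableSet s → 0 ≤ ∫ x in s, L x ∂ρ ∧ ∫ x in s, L x ∂ρ ≤ ρ.real s := by
    intro s hs
    have := Set.mem_iInter.1 hℓC ⟨s, hs⟩
    simp only [Set.mem_ofPred_eq] at this
    rw [hℓ, real_inner_comm, L2.inner_indicatorConstLp_one] at this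
    exact this
  have h0 : 0 ≤ᵐ[ρ] L := ae_nonneg_of_forall_setIntegral_nonneg hLi fun s m _ => (hs s m).1
  have h1 : L ≤ᵐ[ρ] fun _ => (1 : ℝ) :=
    ae_le_of_forall_setIntegral_le hLi (integrable_const _) fun s m _ => by
      simpa using (hs s m).2
  let g : Ω → ℝ := (Lp.aestronglyMeasurable L).mk L
  have hg : Measurable g := (Lp.aestronglyMeasurable L).stronglyMeasurable_mk.measurable
  refine ⟨fun x => max 0 (min 1 (g x)), measurable_const.max (measurable_const.min hg),
    fun x => ⟨le_max_left _ _, max_le zero_le_one (min_le_left _ _)⟩, fun i => ?_⟩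
  have := Set.mem_iInter.1 hℓT i
  simp only [T, Set.mem_ofPred_eq] at this
  have e : ℓ (V i) = ∫ x, max 0 (min 1 (g x)) * v i x ∂ρ := by
    rw [hℓ, L2.inner_def]
    refine integral_congr_ae ?_
    filter_upwards [(Lp.aestronglyMeasurable L).ae_eq_mk, (hv i).coeFn_toLp, h0, h1]
      with x k1 k2 k3 k4
    have k5 : g x = L x := k1.symm
    simp only [V, k2, k5, RCLike.inner_apply, conj_trivial]
    rw [min_eq_right k4, max_eq_right (show (0 : ℝ) ≤ L x from k3)]
    ring
  rwa [e] at this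

/-- Decomposition for a sigma-finite measure. -/
theorem aux_main {Ω₁ Ω₂ : Type*} [MeasurableSpace Ω₁] [MeasurableSpace Ω₂]
    (μ₁ : Measure Ω₁) (μ₂ : Measure Ω₂) [SigmaFinite μ₁] [SigmaFinite μ₂]
    (ν : Measure (Ω₁ × Ω₂)) [SigmaFinite ν]
    (θ₁ θ₂ : ℝ) (h01 : 0 < θ₁) (h11 : θ₁ ≤ 1) (h02 : 0 < θ₂)
    (h12 : θ₂ ≤ 1)
    (hν : ∀ (E₁ : Set Ω₁) (E₂ : Set Ω₂), MeasurableSet E₁ → MeasurableSet E₂ →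
      μ₁ E₁ < ∞ → μ₂ E₂ < ∞ → ν (E₁ ×ˢ E₂) ≤ μ₁ E₁ ^ θ₁ + μ₂ E₂ ^ θ₂) :
    ∃ h : Ω₁ × Ω₂ → ℝ, Measurable h ∧ (∀ x, 0 ≤ h x ∧ h x ≤ 1) ∧
      (∀ E, MeasurableSet E → μ₁ E < ∞ →
        ∫⁻ x in E ×ˢ Set.univ, ENNReal.ofReal (h x) ∂ν ≤ μ₁ E ^ θ₁) ∧
      (∀ G, MeasurableSet G → μ₂ G < ∞ →
        ∫⁻ x in Set.univ ×ˢ G, ENNReal.ofReal (1 - h x) ∂ν ≤ μ₂ G ^ θ₂) := by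
  obtain ⟨w, hw0, hwm, hw1⟩ := exists_pos_lintegral_lt_of_sigmaFinite ν one_ne_zero
  let ρ := ν.withDensity (fun x => (w x : ℝ≥0∞))
  have hρ : IsFiniteMeasure ρ := isFiniteMeasure_withDensity hw1.ne_top
  let B : ℕ → Set (Ω₁ × Ω₂) := fun n => {x | ((w x)⁻¹ : NNReal) ≤ n}
  have hBm : ∀ n, MeasurableSet (B n) := fun n => measurableSet_le hwm.inv measurable_const
  have hBmono : Monotone B := fun m n hmn x hx => le_trans (b := (m : NNReal)) hx (by exact_mod_cast hmn)
  have hBU : ∀ x, ∃ n, x ∈ B n := fun x => exists_nat_ge ((w x)⁻¹)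
  let ι := {k : Set Ω₁ × Set Ω₂ × ℕ // MeasurableSet k.1 ∧ MeasurableSet k.2.1 ∧
    μ₁ k.1 < ∞ ∧ μ₂ k.2.1 < ∞}
  let R : ι → Set (Ω₁ × Ω₂) := fun k => (k.1.1 ×ˢ k.1.2.1) ∩ B k.1.2.2
  have hR : ∀ k, MeasurableSet (R k) := fun k => (k.2.1.prod k.2.2.1).inter (hBm _)
  let v : ι → Ω₁ × Ω₂ → ℝ := fun k => (R k).indicator fun x => (((w x)⁻¹ : NNReal) : ℝ)
  have hvm : ∀ k, Measurable (v k) := fun k => (hwm.inv.coe_nnreal_real).indicator (hR k)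
  have hv0 : ∀ k x, 0 ≤ v k x := fun k x => Set.indicator_nonneg (fun _ _ => NNReal.coe_nonneg _) x
  have hvb : ∀ k x, ‖v k x‖ ≤ k.1.2.2 := by
    intro k x
    rw [Real.norm_of_nonneg (hv0 k x)]
    by_cases hx : x ∈ R k
    · simp only [v, Set.indicator_of_mem hx]
      exact_mod_cast hx.2
    · simp [v, hx]
  have hvL : ∀ k, MemLp (v k) 2 ρ := fun k =>
    MemLp.of_bound (hvm k).aestronglyMeasurable _ (ae_of_all _ (hvb k))
  have hvi : ∀ k, Integrable (v k) ρ := fun k => (hvL k).integrable (by norm_num)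
  have hhi : ∀ (h : Ω₁ × Ω₂ → ℝ), Measurable h → (∀ x, 0 ≤ h x ∧ h x ≤ 1) → ∀ k,
      Integrable (fun x => h x * v k x) ρ := fun h hm hb k =>
    (hvi k).bdd_mul (c := 1) hm.aestronglyMeasurable
      (ae_of_all _ fun x => by rw [Real.norm_of_nonneg (hb x).1]; exact (hb x).2)
  have bridge : ∀ (h : Ω₁ × Ω₂ → ℝ), Measurable h → (∀ x, 0 ≤ h x ∧ h x ≤ 1) → ∀ k,
      ENNReal.ofReal (∫ x, h x * v k x ∂ρ) = ∫⁻ x in R k, ENNReal.ofReal (h x) ∂ν := by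
    intro h hm hb k
    rw [ofReal_integral_eq_lintegral_ofReal (hhi h hm hb k)
      (ae_of_all _ fun x => mul_nonneg (hb x).1 (hv0 k x))]
    have hmv : Measurable fun x => ENNReal.ofReal (h x * v k x) :=
      (hm.mul (hvm k)).ennreal_ofReal
    rw [lintegral_withDensity_eq_lintegral_mul _ hwm.coe_nnreal_ennreal hmv, ← lintegral_indicator (hR k)]
    refine lintegral_congr fun x => ?_
    by_cases hx : x ∈ R k
    · simp only [Pi.mul_apply, v, Set.indicator_of_mem hx]
      rw [ENNReal.ofReal_mul (hb x).1, ENNReal.ofReal_coe_nnreal, mul_left_comm,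
        ← ENNReal.coe_mul, mul_inv_cancel₀ (hw0 x).ne', ENNReal.coe_one, mul_one]
    · simp [v, hx]
  have hsub : ∀ (h : Ω₁ × Ω₂ → ℝ), Measurable h → (∀ x, 0 ≤ h x ∧ h x ≤ 1) → ∀ k,
      ∫ x, (1 - h x) * v k x ∂ρ = ∫ x, v k x ∂ρ - ∫ x, h x * v k x ∂ρ := by
    intro h hm hb k
    rw [← integral_sub (hvi k) (hhi h hm hb k)]
    simp only [sub_mul, one_mul]
  have t1 : ∀ k : ι, μ₁ k.1.1 ^ θ₁ ≠ ∞ := fun k =>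
    ENNReal.rpow_ne_top_of_nonneg h01.le k.2.2.2.1.ne
  have t2 : ∀ k : ι, μ₂ k.1.2.1 ^ θ₂ ≠ ∞ := fun k =>
    ENNReal.rpow_ne_top_of_nonneg h02.le k.2.2.2.2.ne
  obtain ⟨h, hm, hb, hh⟩ := aux_compact ρ v hvL
    (fun k => ∫ x, v k x ∂ρ - (μ₂ k.1.2.1 ^ θ₂).toReal) (fun k => (μ₁ k.1.1 ^ θ₁).toReal) (by
      intro u
      obtain ⟨h, hm, hb, hh⟩ := aux_finite' (K := u) μ₁ μ₂ ν θ₁ θ₂ h01 h11 h02 h12 hν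
        (fun k => k.1.1.1) (fun k => k.1.1.2.1) (fun k => k.1.2.1) (fun k => k.1.2.2.1)
        (fun k => k.1.2.2.2.1) (fun k => k.1.2.2.2.2)
      refine ⟨h, hm, hb, fun k hk => ?_⟩
      have hh' := hh ⟨k, hk⟩
      have e1 := bridge h hm hb k
      have e2 := bridge (fun x => 1 - h x) (measurable_const.sub hm)
        (fun x => ⟨by linarith [(hb x).2], by linarith [(hb x).1]⟩) k
      rw [hsub h hm hb] at e2
      have f1 := e1.le.trans ((lintegral_mono_set Set.inter_subset_left).trans hh'.1)
      have f2 := e2.le.trans ((lintegral_mono_set Set.inter_subset_left).trans hh'.2)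
      rw [ENNReal.ofReal_le_iff_le_toReal (t1 k)] at f1
      rw [ENNReal.ofReal_le_iff_le_toReal (t2 k)] at f2
      exact ⟨by linarith, f1⟩)
  have hb' : ∀ x, 0 ≤ 1 - h x ∧ 1 - h x ≤ 1 := fun x =>
    ⟨by linarith [(hb x).2], by linarith [(hb x).1]⟩
  refine ⟨h, hm, hb, fun E hE hE' => ?_, fun G hG hG' => ?_⟩
  · let k : ℕ → ι := fun n => ⟨(E, spanningSets μ₂ n, n), hE, measurableSet_spanningSets μ₂ n, hE',
      measure_spanningSets_lt_top μ₂ n⟩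
    have hmono : Monotone fun n => R (k n) := fun m n hmn =>
      Set.inter_subset_inter (Set.prod_mono le_rfl (monotone_spanningSets μ₂ hmn)) (hBmono hmn)
    have hU : E ×ˢ Set.univ ⊆ ⋃ n, R (k n) := by
      rintro ⟨x, y⟩ ⟨hx, -⟩
      obtain ⟨n, hn⟩ := hBU (x, y)
      obtain ⟨m, hm⟩ := Set.mem_iUnion.1 ((iUnion_spanningSets μ₂).ge (Set.mem_univ y))
      exact Set.mem_iUnion.2 ⟨max m n, ⟨hx, monotone_spanningSets μ₂ (le_max_left m n) hm⟩,
        hBmono (le_max_right m n) hn⟩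
    refine (lintegral_mono_set hU).trans ?_
    rw [setLIntegral_iUnion_of_directed _ hmono.directed_le]
    refine iSup_le fun n => ?_
    rw [← bridge h hm hb]
    exact (ENNReal.ofReal_le_iff_le_toReal (t1 (k n))).2 (hh (k n)).2
  · let k : ℕ → ι := fun n => ⟨(spanningSets μ₁ n, G, n), measurableSet_spanningSets μ₁ n, hG,
      measure_spanningSets_lt_top μ₁ n, hG'⟩
    have hmono : Monotone fun n => R (k n) := fun m n hmn =>
      Set.inter_subset_inter (Set.prod_mono (monotone_spanningSets μ₁ hmn) le_rfl) (hBmono hmn)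
    have hU : Set.univ ×ˢ G ⊆ ⋃ n, R (k n) := by
      rintro ⟨x, y⟩ ⟨-, hy⟩
      obtain ⟨n, hn⟩ := hBU (x, y)
      obtain ⟨m, hm⟩ := Set.mem_iUnion.1 ((iUnion_spanningSets μ₁).ge (Set.mem_univ x))
      exact Set.mem_iUnion.2 ⟨max m n, ⟨monotone_spanningSets μ₁ (le_max_left m n) hm, hy⟩,
        hBmono (le_max_right m n) hn⟩
    refine (lintegral_mono_set hU).trans ?_
    rw [setLIntegral_iUnion_of_directed _ hmono.directed_le]
    refine iSup_le fun n => ?_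
    rw [← bridge (fun x => 1 - h x) (measurable_const.sub hm) hb', hsub h hm hb]
    refine (ENNReal.ofReal_le_iff_le_toReal (t2 (k n))).2 ?_
    have := (hh (k n)).1
    change _ ≤ (μ₂ (k n).1.2.1 ^ θ₂).toReal
    linarith

theorem aux_norm {Ω₁ Ω₂ : Type*} [MeasurableSpace Ω₁] [MeasurableSpace Ω₂]
    (μ₁ : Measure Ω₁) (μ₂ : Measure Ω₂) [SigmaFinite μ₁] [SigmaFinite μ₂] (p' : ℝ)
    (g : Ω₁ × Ω₂ → ℝ) (hg : Measurable g)
    (H : ∀ E, MeasurableSet E → μ₁ E < ∞ →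
      ∫⁻ x in E ×ˢ Set.univ, ‖g x‖₊ ∂(μ₁.prod μ₂) ≤ μ₁ E ^ (1 / p')) :
    mixedWeakNorm μ₁ μ₂ p' g ≤ 1 := by
  refine iSup_le fun E => iSup_le fun hE => iSup_le fun h0 => iSup_le fun h1 => ?_
  have e : ∫⁻ ω₁ in E, (∫⁻ ω₂, ‖g (ω₁, ω₂)‖₊ ∂μ₂) ∂μ₁ =
      ∫⁻ x in E ×ˢ Set.univ, ‖g x‖₊ ∂(μ₁.prod μ₂) := by
    rw [← Measure.prod_restrict, Measure.restrict_univ, lintegral_prod]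
    exact hg.nnnorm.coe_nnreal_ennreal.aemeasurable
  rw [e]
  calc _ ≤ μ₁ E ^ (-(1 / p')) * μ₁ E ^ (1 / p') := by gcongr; exact H E hE h1
    _ = 1 := by
      rw [← ENNReal.rpow_add _ _ h0.ne' h1.ne, neg_add_cancel, ENNReal.rpow_zero]

theorem main_decomposition_lemma
    {Ω₁ Ω₂ : Type*} [MeasurableSpace Ω₁] [MeasurableSpace Ω₂]
    (μ₁ : Measure Ω₁) (μ₂ : Measure Ω₂) [SigmaFinite μ₁] [SigmaFinite μ₂]
    (p₁ p₂ p₁' p₂' : ℝ) (hp₁ : 1 < p₁) (hp₂ : 1 < p₂)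
    (hp₁' : p₁' = p₁ / (p₁ - 1)) (hp₂' : p₂' = p₂ / (p₂ - 1))
    (f : Ω₁ × Ω₂ → ℝ) (hf : Measurable f)
    (hbound : ∀ E₁ E₂ : Set _, MeasurableSet E₁ → MeasurableSet E₂ →
      μ₁ E₁ < ∞ → μ₂ E₂ < ∞ →
      ∫⁻ x in E₁ ×ˢ E₂, ‖f x‖₊ ∂(μ₁.prod μ₂) ≤ μ₁ E₁ ^ (1 / p₁') + μ₂ E₂ ^ (1 / p₂')) :
    ∃ f₁ f₂ : Ω₁ × Ω₂ → ℝ, Measurable f₁ ∧ Measurable f₂ ∧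
      f =ᵐ[μ₁.prod μ₂] f₁ + f₂ ∧
      mixedWeakNorm μ₁ μ₂ p₁' f₁
        + mixedWeakNorm μ₂ μ₁ p₂' (fun ω => f₂ (ω.2, ω.1)) ≤ 2 := by
  have hθ : ∀ p p' : ℝ, 1 < p → p' = p / (p - 1) → 0 < 1 / p' ∧ 1 / p' ≤ 1 := by
    intro p p' hp hp'
    have h1 : 0 < p - 1 := by linarith
    have h2 : 0 < p := by linarith
    rw [hp', one_div_div]
    exact ⟨div_pos h1 h2, (div_le_one h2).2 (by linarith)⟩
  obtain ⟨h01, h11⟩ := hθ _ _ hp₁ hp₁'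
  obtain ⟨h02, h12⟩ := hθ _ _ hp₂ hp₂'
  let ν : Measure (Ω₁ × Ω₂) := (μ₁.prod μ₂).withDensity fun x => (‖f x‖₊ : ℝ≥0∞)
  have hνs : SigmaFinite ν :=
    SigmaFinite.withDensity_of_ne_top (ae_of_all _ fun x => ENNReal.coe_ne_top)
  have hfm : Measurable fun x => (‖f x‖₊ : ℝ≥0∞) := hf.nnnorm.coe_nnreal_ennreal
  obtain ⟨h, hm, hb, h1, h2⟩ := aux_main μ₁ μ₂ ν (1 / p₁') (1 / p₂') h01 h11 h02 h12 (by
    intro E₁ E₂ m1 m2 l1 l2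
    rw [withDensity_apply _ (m1.prod m2)]
    exact hbound E₁ E₂ m1 m2 l1 l2)
  have conv : ∀ (g : Ω₁ × Ω₂ → ℝ) (hg : Measurable g) (hg0 : ∀ x, 0 ≤ g x)
      (S : Set (Ω₁ × Ω₂)) (hS : MeasurableSet S),
      ∫⁻ x in S, ‖g x * f x‖₊ ∂(μ₁.prod μ₂) = ∫⁻ x in S, ENNReal.ofReal (g x) ∂ν := by
    intro g hg hg0 S hS
    rw [setLIntegral_withDensity_eq_setLIntegral_mul _ hfm hg.ennreal_ofReal hS]
    refine lintegral_congr fun x => ?_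
    rw [Pi.mul_apply, nnnorm_mul, ENNReal.coe_mul, mul_comm]
    congr 1
    rw [← enorm_eq_nnnorm, Real.enorm_eq_ofReal (hg0 x)]
  refine ⟨fun x => h x * f x, fun x => (1 - h x) * f x, hm.mul hf,
    (measurable_const.sub hm).mul hf, ae_of_all _ fun x => ?_, ?_⟩
  · simp only [Pi.add_apply]; ring
  · rw [← one_add_one_eq_two]
    refine add_le_add (aux_norm μ₁ μ₂ _ _ (hm.mul hf) fun E hE hE' => ?_)
      (aux_norm μ₂ μ₁ _ _ (((measurable_const.sub hm).mul hf).comp measurable_swap)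
        fun E hE hE' => ?_)
    · rw [conv h hm (fun x => (hb x).1) _ (hE.prod .univ)]
      exact h1 E hE hE'
    · refine le_trans (le_of_eq ?_) (h2 E hE hE')
      rw [← conv (fun x => 1 - h x) (measurable_const.sub hm)
        (fun x => sub_nonneg.2 (hb x).2) _ (MeasurableSet.univ.prod hE)]
      have mp := (Measure.measurePreserving_swap (μ := μ₂) (ν := μ₁)).restrict_preimage
        (MeasurableSet.univ.prod hE)
      have hq : Measurable fun x => (‖(1 - h x) * f x‖₊ : ℝ≥0∞) :=
        ((measurable_const.sub hm).mul hf).nnnorm.coe_nnreal_ennreal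
      rw [← mp.lintegral_comp hq]
      congr 2
      ext x; simp
end

section
/- (Decomposition for general exponent q.) Let 0 < q < ∞ and 1 < p₁, p₂ < ∞ with pⱼ' = pⱼ/(pⱼ−1). Suppose f : Ω₁ × Ω₂ → ℝ is measurable and for every pair of measurable sets E₁ ⊆ Ω₁, E₂ ⊆ Ω₂ of finite measure one has ∫_{E₁×E₂} |f|^q d(μ₁×μ₂) ≤ μ₁(E₁)^{1/p₁'} + μ₂(E₂)^{1/p₂'}. Then there exist measurable functions f₁, f₂ with f = f₁ + f₂ (μ₁×μ₂)-almost everywhere, sup over measurable E ⊆ Ω₁ with 0 < μ₁(E) < ∞ of μ₁(E)^{−1/p₁'} ∫_E (∫ |f₁(ω₁,ω₂)|^q dμ₂(ω₂)) dμ₁(ω₁) ≤ 4, and sup over measurable E ⊆ Ω₂ with 0 < μ₂(E) < ∞ of μ₂(E)^{−1/p₂'} ∫_E (∫ |f₂(ω₁,ω₂)|^q dμ₁(ω₁)) dμ₂(ω₂) ≤ 4. (In other words, f₁ ∈ L_{qp₁,∞}(μ₁;L_q(μ₂)) and f₂ ∈ L_{qp₂,∞}(μ₂;L_q(μ₁)).)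 -/
open MeasureTheory ENNReal
open scoped NNReal

namespace DecompAux

lemma real_submod {a x y z w : ℝ} (ha0 : 0 ≤ a) (ha1 : a ≤ 1) (hz : 0 ≤ z) (hzx : z ≤ x)
    (hzy : z ≤ y) (h : w + z = x + y) : w ^ a + z ^ a ≤ x ^ a + y ^ a := by
  rcases eq_or_lt_of_le (show z ≤ w by linarith) with hw | hw
  · have h1 : x = z := by linarith
    have h2 : y = z := by linarith
    rw [h1, h2, ← hw]
  · have hc := (Real.concaveOn_rpow ha0 ha1).2
    have hd : 0 < w - z := by linarith
    have hwm : w ∈ Set.Ici (0 : ℝ) := by simp; linarith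
    have hzm : z ∈ Set.Ici (0 : ℝ) := by simpa using hz
    have hl0 : 0 ≤ (x - z) / (w - z) := div_nonneg (by linarith) hd.le
    have hm0 : 0 ≤ (y - z) / (w - z) := div_nonneg (by linarith) hd.le
    have hs : (x - z) / (w - z) + (y - z) / (w - z) = 1 := by
      rw [← add_div, div_eq_one_iff_eq hd.ne']; linarith
    have h1 := hc hwm hzm hl0 hm0 hs
    have h2 := hc hzm hwm hl0 hm0 hs
    have e1 : (x - z) / (w - z) * w + (y - z) / (w - z) * z = x := by
      have : y = w + z - x := by linarith
      subst this
      field_simp; ring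
    have e2 : (x - z) / (w - z) * z + (y - z) / (w - z) * w = y := by
      have : y = w + z - x := by linarith
      subst this
      field_simp; ring
    simp only [smul_eq_mul] at h1 h2
    rw [e1] at h1
    rw [e2] at h2
    have e3 : (x - z) / (w - z) = 1 - (y - z) / (w - z) := by linarith
    rw [e3] at h1 h2
    nlinarith

lemma measure_submod {Ω : Type*} [MeasurableSpace Ω] (μ : Measure Ω) {a : ℝ} (ha0 : 0 ≤ a)
    (ha1 : a ≤ 1) {A B : Set Ω} (hB : MeasurableSet B)
    (hAf : μ A < ∞) (hBf : μ B < ∞) :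
    μ (A ∪ B) ^ a + μ (A ∩ B) ^ a ≤ μ A ^ a + μ B ^ a := by
  have hU : μ (A ∪ B) < ∞ := measure_union_lt_top hAf hBf
  have hI : μ (A ∩ B) < ∞ := (measure_mono Set.inter_subset_left).trans_lt hAf
  have h := measure_union_add_inter A hB (μ := μ)
  have hx := measure_mono (μ := μ) (Set.inter_subset_left : A ∩ B ⊆ A)
  have hy := measure_mono (μ := μ) (Set.inter_subset_right : A ∩ B ⊆ B)
  generalize μ (A ∪ B) = w at *
  generalize μ (A ∩ B) = z at *
  generalize μ A = x at *
  generalize μ B = y at *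
  lift x to ℝ≥0 using hAf.ne
  lift y to ℝ≥0 using hBf.ne
  lift z to ℝ≥0 using hI.ne
  lift w to ℝ≥0 using hU.ne
  norm_cast at h hx hy
  simp only [← ENNReal.coe_rpow_of_nonneg _ ha0]
  norm_cast
  rw [← NNReal.coe_le_coe]
  push_cast
  exact real_submod ha0 ha1 z.2 hx hy (by exact_mod_cast h)

/-- Nonnegative simple functions together with the cost of a representation. -/
inductive Cost {Ω : Type*} [MeasurableSpace Ω] (μ : Measure Ω) (a : ℝ) : (Ω → ℝ) → ℝ → Prop
  | zero : Cost μ a 0 0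
  | step (u : Ω → ℝ) (r : ℝ) (c : ℝ) (E : Set Ω) : Cost μ a u r → 0 ≤ c → MeasurableSet E →
      μ E < ∞ → Cost μ a (u + E.indicator (fun _ => c)) (r + c * (μ E ^ a).toReal)

section
variable {Ω : Type*} [MeasurableSpace Ω] {μ : Measure Ω} {a : ℝ}

lemma Cost.add {u v : Ω → ℝ} {r s : ℝ} (hu : Cost μ a u r) (hv : Cost μ a v s) :
    Cost μ a (u + v) (r + s) := by
  induction hv with
  | zero => simpa using hu
  | step v s c E _ hc hE hEf ih =>
    rw [← add_assoc, ← add_assoc]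
    exact Cost.step _ _ _ _ ih hc hE hEf

lemma Cost.smul {u : Ω → ℝ} {r : ℝ} (hu : Cost μ a u r) {k : ℝ} (hk : 0 ≤ k) :
    Cost μ a (k • u) (k * r) := by
  induction hu with
  | zero => simpa using Cost.zero
  | step v s c E _ hc hE hEf ih =>
    have := Cost.step _ _ (k * c) E ih (mul_nonneg hk hc) hE hEf
    convert this using 1
    · rw [smul_add]; congr 1; ext x; by_cases hx : x ∈ E <;> simp [hx]
    · ring

lemma Cost.nonneg {u : Ω → ℝ} {r : ℝ} (hu : Cost μ a u r) : 0 ≤ r ∧ ∀ x, 0 ≤ u x := by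
  induction hu with
  | zero => simp
  | step v s c E _ hc hE hEf ih =>
    refine ⟨add_nonneg ih.1 (by positivity), fun x => add_nonneg (ih.2 x) ?_⟩
    exact Set.indicator_nonneg (fun _ _ => hc) x

lemma Cost.measurable {u : Ω → ℝ} {r : ℝ} (hu : Cost μ a u r) : Measurable u := by
  induction hu with
  | zero => exact measurable_const
  | step v s c E _ hc hE hEf ih => exact ih.add (measurable_const.indicator hE)

lemma Cost.finite {u : Ω → ℝ} {r : ℝ} (hu : Cost μ a u r) {t : ℝ} (ht : 0 ≤ t) :
    μ {x | t < u x} < ∞ := by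
  have h0 : μ {x | 0 < u x} < ∞ := by
    induction hu with
    | zero => simp
    | step v s c E hv hc hE hEf ih =>
      refine (measure_mono ?_).trans_lt (measure_union_lt_top ih hEf)
      intro x hx
      by_cases hxE : x ∈ E
      · exact Or.inr hxE
      · left; simpa [hxE] using hx
  exact (measure_mono fun x (hx : t < u x) => ht.trans_lt hx).trans_lt h0

lemma Cost.choquet (ha0 : 0 < a) (ha1 : a ≤ 1) {u : Ω → ℝ} {r : ℝ} (hu : Cost μ a u r) :
    ∫⁻ t in Set.Ioi (0 : ℝ), μ {x | t < u x} ^ a ≤ ENNReal.ofReal r := by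
  have meas : ∀ (E : Set Ω) (w : Ω → ℝ), Measurable fun t : ℝ => μ (E ∩ {x | t < w x}) ^ a := by
    intro E w
    refine Antitone.measurable fun s t hst => ?_
    refine ENNReal.rpow_le_rpow (measure_mono ?_) ha0.le
    exact Set.inter_subset_inter_right _ fun x hx => lt_of_le_of_lt hst hx
  induction hu with
  | zero =>
    have : ∀ t ∈ Set.Ioi (0 : ℝ), μ {x | t < (0 : Ω → ℝ) x} ^ a = 0 := by
      intro t ht
      have : {x | t < (0 : Ω → ℝ) x} = ∅ := by
        ext x; simp; exact le_of_lt ht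
      rw [this]; simp [ha0]
    rw [setLIntegral_congr_fun measurableSet_Ioi this]
    simp
  | step v s c E hv hc hE hEf ih =>
    have hEa : μ E ^ a < ∞ := ENNReal.rpow_lt_top_of_nonneg ha0.le hEf.ne
    have hfin : ∫⁻ t in Set.Ioi (0 : ℝ), μ (E ∩ {x | t < v x}) ^ a < ∞ := by
      refine (lintegral_mono fun t => ?_).trans_lt (ih.trans_lt ENNReal.ofReal_lt_top)
      exact ENNReal.rpow_le_rpow (measure_mono Set.inter_subset_right) ha0.le
    have hmv := hv.measurable
    have key : ∀ t ∈ Set.Ioi (0 : ℝ),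
        μ {x | t < (v + E.indicator (fun _ => c)) x} ^ a + μ (E ∩ {x | t < v x}) ^ a
          ≤ μ {x | t < v x} ^ a + μ (E ∩ {x | t - c < v x}) ^ a := by
      intro t ht
      have hB : MeasurableSet (E ∩ {x | t - c < v x}) :=
        hE.inter (measurableSet_lt measurable_const hmv)
      have h := measure_submod μ ha0.le ha1 hB (hv.finite (le_of_lt ht))
        ((measure_mono Set.inter_subset_left).trans_lt hEf)
      convert h using 4
      · ext x
        by_cases hx : x ∈ E
        · simp [hx]
          constructor
          · intro h; right; linarith
          · rintro (h | h) <;> linarith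
        · simp [hx]
      · ext x
        simp
        constructor
        · rintro ⟨h1, h2⟩; exact ⟨h2, h1, by linarith⟩
        · rintro ⟨h1, h2, h3⟩; exact ⟨h2, h1⟩
    have h1 := setLIntegral_mono' (μ := volume) measurableSet_Ioi key
    have m1 : Measurable fun t : ℝ => μ {x | t < v x} ^ a := by
      simpa using meas Set.univ v
    rw [lintegral_add_right _ (meas E v), lintegral_add_left m1] at h1
    have h2 : ∫⁻ t in Set.Ioi (0 : ℝ), μ (E ∩ {x | t - c < v x}) ^ a
        ≤ ENNReal.ofReal c * μ E ^ a + ∫⁻ t in Set.Ioi (0 : ℝ), μ (E ∩ {x | t < v x}) ^ a := by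
      have e : ∫⁻ t in Set.Ioi (0 : ℝ), μ (E ∩ {x | t - c < v x}) ^ a
          = ∫⁻ t in Set.Ioi (-c), μ (E ∩ {x | t < v x}) ^ a := by
        rw [← lintegral_indicator measurableSet_Ioi, ← lintegral_indicator measurableSet_Ioi,
          ← lintegral_sub_right_eq_self
            ((Set.Ioi (-c)).indicator fun t => μ (E ∩ {x | t < v x}) ^ a) c]
        congr 1
        ext t
        simp only [Set.indicator, Set.mem_Ioi]
        congr 1
        simp
      have hsplit : Set.Ioi (-c) = Set.Ioc (-c) 0 ∪ Set.Ioi 0 :=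
        (Set.Ioc_union_Ioi_eq_Ioi (by linarith)).symm
      rw [e, hsplit]
      refine (lintegral_union_le _ _ _).trans (add_le_add ?_ le_rfl)
      refine (lintegral_mono (g := fun _ => μ E ^ a) fun t =>
        ENNReal.rpow_le_rpow (measure_mono Set.inter_subset_left) ha0.le).trans ?_
      simp [mul_comm]
    have h3 : ENNReal.ofReal (s + c * (μ E ^ a).toReal)
        = ENNReal.ofReal s + ENNReal.ofReal c * μ E ^ a := by
      rw [ENNReal.ofReal_add hv.nonneg.1 (by positivity), ENNReal.ofReal_mul hc,
        ENNReal.ofReal_toReal hEa.ne]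
    rw [h3]
    refine (ENNReal.add_le_add_iff_right hfin.ne).1 (h1.trans ?_)
    rw [add_assoc]
    exact add_le_add ih h2

end

section
variable {Ω₁ Ω₂ : Type*} [MeasurableSpace Ω₁] [MeasurableSpace Ω₂]
  {μ₁ : Measure Ω₁} {μ₂ : Measure Ω₂} {a b : ℝ} {κ : Measure (Ω₁ × Ω₂)} {ρ : Ω₁ × Ω₂ → ℝ≥0}

lemma pairing (ha0 : 0 < a) (ha1 : a ≤ 1) (hb0 : 0 < b) (hb1 : b ≤ 1) (hρ : Measurable ρ)
    (hbd : ∀ (E₁ : Set Ω₁) (E₂ : Set Ω₂), MeasurableSet E₁ → MeasurableSet E₂ →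
      μ₁ E₁ < ∞ → μ₂ E₂ < ∞ →
      ∫⁻ x in E₁ ×ˢ E₂, (ρ x : ℝ≥0∞) ∂κ ≤ μ₁ E₁ ^ a + μ₂ E₂ ^ b)
    {u : Ω₁ → ℝ} {v : Ω₂ → ℝ} {r s : ℝ} (hu : Cost μ₁ a u r) (hv : Cost μ₂ b v s) :
    ∫⁻ x, (ρ x : ℝ≥0∞) * ENNReal.ofReal (min (u x.1) (v x.2)) ∂κ ≤ ENNReal.ofReal (r + s) := by
  have hum := hu.measurable
  have hvm := hv.measurable
  have hm : Measurable fun x : Ω₁ × Ω₂ => min (u x.1) (v x.2) :=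
    (hum.comp measurable_fst).min (hvm.comp measurable_snd)
  have e : ∫⁻ x, (ρ x : ℝ≥0∞) * ENNReal.ofReal (min (u x.1) (v x.2)) ∂κ
      = ∫⁻ x, ENNReal.ofReal (min (u x.1) (v x.2)) ∂(κ.withDensity fun x => (ρ x : ℝ≥0∞)) := by
    rw [lintegral_withDensity_eq_lintegral_mul _ hρ.coe_nnreal_ennreal hm.ennreal_ofReal]
    rfl
  rw [e, lintegral_eq_lintegral_meas_lt _
    (Filter.Eventually.of_forall fun x => le_min (hu.nonneg.2 _) (hv.nonneg.2 _)) hm.aemeasurable,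
    ENNReal.ofReal_add hu.nonneg.1 hv.nonneg.1]
  have m1 : Measurable fun t : ℝ => μ₁ {x | t < u x} ^ a := by
    refine Antitone.measurable fun s t hst => ?_
    exact ENNReal.rpow_le_rpow (measure_mono fun x hx => lt_of_le_of_lt hst hx) ha0.le
  refine le_trans ?_ (add_le_add (hu.choquet ha0 ha1) (hv.choquet hb0 hb1))
  rw [← lintegral_add_left m1]
  refine setLIntegral_mono' measurableSet_Ioi fun t ht => ?_
  have hset : {x : Ω₁ × Ω₂ | t < min (u x.1) (v x.2)} = {x | t < u x} ×ˢ {y | t < v y} := by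
    ext x; simp
  have h1 : MeasurableSet {x | t < u x} := measurableSet_lt measurable_const hum
  have h2 : MeasurableSet {x | t < v x} := measurableSet_lt measurable_const hvm
  rw [hset, withDensity_apply _ (h1.prod h2)]
  exact hbd _ _ h1 h2 (hu.finite (le_of_lt ht)) (hv.finite (le_of_lt ht))

lemma Lp_int [IsFiniteMeasure κ] (s : Lp ℝ 2 κ) : Integrable s κ :=
  (Lp.memLp s).integrable (by norm_num)

/-- The cone used in the Hahn-Banach argument. -/
def K (μ₁ : Measure Ω₁) (μ₂ : Measure Ω₂) (a b : ℝ) (κ : Measure (Ω₁ × Ω₂))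
    (ρ : Ω₁ × Ω₂ → ℝ≥0) (p : Lp ℝ 2 κ × ℝ) : Prop :=
  ∃ (u : Ω₁ → ℝ) (r : ℝ) (v : Ω₂ → ℝ) (t : ℝ) (c : Lp ℝ 2 κ), Cost μ₁ a u r ∧ Cost μ₂ b v t ∧
    (∀ᵐ x ∂κ, c x ≤ ρ x * v x.2) ∧ (∀ᵐ x ∂κ, p.1 x + c x ≤ ρ x * u x.1) ∧
    r + t - ∫ x, c x ∂κ ≤ p.2

lemma K_add [IsFiniteMeasure κ] {p p' : Lp ℝ 2 κ × ℝ} (h : K μ₁ μ₂ a b κ ρ p)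
    (h' : K μ₁ μ₂ a b κ ρ p') : K μ₁ μ₂ a b κ ρ (p + p') := by
  obtain ⟨u, r, v, t, c, hu, hv, h1, h2, h3⟩ := h
  obtain ⟨u', r', v', t', c', hu', hv', h1', h2', h3'⟩ := h'
  refine ⟨_, _, _, _, c + c', hu.add hu', hv.add hv', ?_, ?_, ?_⟩
  · filter_upwards [h1, h1', Lp.coeFn_add c c'] with x a1 a2 a3
    rw [a3]; simp only [Pi.add_apply]; linarith
  · filter_upwards [h2, h2', Lp.coeFn_add c c', Lp.coeFn_add p.1 p'.1] with x a1 a2 a3 a4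
    rw [a3, Prod.fst_add, a4]; simp only [Pi.add_apply]; linarith
  · rw [integral_congr_ae (Lp.coeFn_add c c')]
    simp only [Pi.add_apply]
    rw [integral_add (Lp_int c) (Lp_int c'), Prod.snd_add]
    linarith

lemma K_smul [IsFiniteMeasure κ] {p : Lp ℝ 2 κ × ℝ} (h : K μ₁ μ₂ a b κ ρ p)
    {k : ℝ} (hk : 0 ≤ k) : K μ₁ μ₂ a b κ ρ (k • p) := by
  obtain ⟨u, r, v, t, c, hu, hv, h1, h2, h3⟩ := h
  refine ⟨_, _, _, _, k • c, hu.smul hk, hv.smul hk, ?_, ?_, ?_⟩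
  · filter_upwards [h1, Lp.coeFn_smul k c] with x a1 a3
    rw [a3]; simp only [Pi.smul_apply, smul_eq_mul]
    nlinarith [mul_le_mul_of_nonneg_left a1 hk]
  · filter_upwards [h2, Lp.coeFn_smul k c, Lp.coeFn_smul k p.1] with x a1 a3 a4
    rw [a3, Prod.smul_fst, a4]; simp only [Pi.smul_apply, smul_eq_mul]
    nlinarith [mul_le_mul_of_nonneg_left a1 hk]
  · rw [integral_congr_ae (Lp.coeFn_smul k c)]
    simp only [Pi.smul_apply, smul_eq_mul]
    rw [integral_const_mul, Prod.smul_snd, smul_eq_mul]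
    nlinarith [mul_le_mul_of_nonneg_left h3 hk]

lemma K_zero [IsFiniteMeasure κ] : K μ₁ μ₂ a b κ ρ 0 := by
  refine ⟨_, _, _, _, 0, Cost.zero, Cost.zero, ?_, ?_, ?_⟩
  · filter_upwards [Lp.coeFn_zero ℝ 2 κ] with x a1
    rw [a1]; simp
  · filter_upwards [Lp.coeFn_zero ℝ 2 κ] with x a1
    rw [Prod.fst_zero, a1]; simp
  · rw [integral_congr_ae (Lp.coeFn_zero ℝ 2 κ)]
    simp

lemma K_abs [IsFiniteMeasure κ] (s : Lp ℝ 2 κ) : K μ₁ μ₂ a b κ ρ (s, ∫ x, |s x| ∂κ) := by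
  refine ⟨_, _, _, _, -|s|, Cost.zero, Cost.zero, ?_, ?_, ?_⟩
  · filter_upwards [Lp.coeFn_neg |s|, Lp.coeFn_abs s] with x a1 a2
    rw [a1, Pi.neg_apply, a2]; simp
  · filter_upwards [Lp.coeFn_neg |s|, Lp.coeFn_abs s] with x a1 a2
    rw [a1, Pi.neg_apply, a2]; simp [le_abs_self]
  · rw [integral_congr_ae (Lp.coeFn_neg |s|)]
    simp only [Pi.neg_apply]
    rw [integral_neg, integral_congr_ae (Lp.coeFn_abs s)]
    simp

lemma K_pos [IsFiniteMeasure κ]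
    (ha0 : 0 < a) (ha1 : a ≤ 1) (hb0 : 0 < b) (hb1 : b ≤ 1) (hρ : Measurable ρ)
    (hbd : ∀ (E₁ : Set Ω₁) (E₂ : Set Ω₂), MeasurableSet E₁ → MeasurableSet E₂ →
      μ₁ E₁ < ∞ → μ₂ E₂ < ∞ →
      ∫⁻ x in E₁ ×ˢ E₂, (ρ x : ℝ≥0∞) ∂κ ≤ μ₁ E₁ ^ a + μ₂ E₂ ^ b)
    {y : ℝ} (h : K μ₁ μ₂ a b κ ρ (0, y)) : 0 ≤ y := by
  obtain ⟨u, r, v, t, c, hu, hv, h1, h2, h3⟩ := h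
  have hp := pairing ha0 ha1 hb0 hb1 hρ hbd hu hv
  have hle : ∫⁻ x, ENNReal.ofReal (c x) ∂κ ≤ ENNReal.ofReal (r + t) := by
    refine (lintegral_mono_ae ?_).trans hp
    filter_upwards [h1, h2, Lp.coeFn_zero ℝ 2 κ] with x a1 a2 a3
    rw [a3] at a2
    simp only [Pi.zero_apply, zero_add] at a2
    rw [← ENNReal.ofReal_coe_nnreal, ← ENNReal.ofReal_mul (ρ x).coe_nonneg]
    refine ENNReal.ofReal_le_ofReal ?_
    rcases min_choice (u x.1) (v x.2) with h | h <;> rw [h] <;> assumption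
  have hi := integral_eq_lintegral_pos_part_sub_lintegral_neg_part (Lp_int c)
  have h4 := ENNReal.toReal_mono ENNReal.ofReal_ne_top hle
  rw [ENNReal.toReal_ofReal (add_nonneg hu.nonneg.1 hv.nonneg.1)] at h4
  have h5 : 0 ≤ (∫⁻ x, ENNReal.ofReal (- c x) ∂κ).toReal := ENNReal.toReal_nonneg
  simp only at h3
  linarith

lemma exists_functional [IsFiniteMeasure κ]
    (ha0 : 0 < a) (ha1 : a ≤ 1) (hb0 : 0 < b) (hb1 : b ≤ 1) (hρ : Measurable ρ)
    (hbd : ∀ (E₁ : Set Ω₁) (E₂ : Set Ω₂), MeasurableSet E₁ → MeasurableSet E₂ →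
      μ₁ E₁ < ∞ → μ₂ E₂ < ∞ →
      ∫⁻ x in E₁ ×ˢ E₂, (ρ x : ℝ≥0∞) ∂κ ≤ μ₁ E₁ ^ a + μ₂ E₂ ^ b) :
    ∃ Λ : Lp ℝ 2 κ →ₗ[ℝ] ℝ, ∀ s y, K μ₁ μ₂ a b κ ρ (s, y) → Λ s ≤ y := by
  let C : PointedCone ℝ (Lp ℝ 2 κ × ℝ) :=
    { carrier := {p | K μ₁ μ₂ a b κ ρ p}
      add_mem' := fun h h' => K_add h h'
      zero_mem' := K_zero
      smul_mem' := fun k _ h => K_smul h k.2 }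
  let f : (Lp ℝ 2 κ × ℝ) →ₗ.[ℝ] ℝ := LinearPMap.snd ⊥ ⊤
  obtain ⟨g, hg, hpos⟩ := riesz_extension C f (by
    rintro ⟨⟨s, y⟩, hs⟩ hmem
    have hs0 : s = 0 := by
      have := hs.1
      simpa using this
    subst hs0
    exact K_pos ha0 ha1 hb0 hb1 hρ hbd hmem) (by
    rintro ⟨s, y⟩
    refine ⟨⟨(0, ∫ x, |s x| ∂κ - y), by simp, by simp⟩, ?_⟩
    have := K_abs (μ₁ := μ₁) (μ₂ := μ₂) (a := a) (b := b) (ρ := ρ) s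
    simpa [C] using this)
  refine ⟨-(g.comp (LinearMap.inl ℝ _ _)), fun s y h => ?_⟩
  have h1 : 0 ≤ g (s, y) := hpos _ h
  have h2 : g (0, y) = y := hg ⟨(0, y), by simp, by simp⟩
  have h3 : g (s, y) = g (s, 0) + g (0, y) := by rw [← map_add]; simp
  simp
  linarith

lemma exists_density [IsFiniteMeasure κ]
    (ha0 : 0 < a) (ha1 : a ≤ 1) (hb0 : 0 < b) (hb1 : b ≤ 1) (hρ : Measurable ρ)
    (hbd : ∀ (E₁ : Set Ω₁) (E₂ : Set Ω₂), MeasurableSet E₁ → MeasurableSet E₂ →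
      μ₁ E₁ < ∞ → μ₂ E₂ < ∞ →
      ∫⁻ x in E₁ ×ˢ E₂, (ρ x : ℝ≥0∞) ∂κ ≤ μ₁ E₁ ^ a + μ₂ E₂ ^ b) :
    ∃ θ : Lp ℝ 2 κ, ∀ s y, K μ₁ μ₂ a b κ ρ (s, y) → ∫ x, θ x * s x ∂κ ≤ y := by
  obtain ⟨Λ, hΛ⟩ := exists_functional ha0 ha1 hb0 hb1 hρ hbd
  have hL1 : ∀ s, Λ s ≤ ∫ x, |s x| ∂κ := fun s => hΛ _ _ (K_abs s)
  let one : Lp ℝ 2 κ := indicatorConstLp 2 MeasurableSet.univ (measure_ne_top κ _) (1 : ℝ)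
  have hL2 : ∀ s, Λ s ≤ ‖one‖ * ‖s‖ := by
    intro s
    refine (hL1 s).trans ?_
    have := real_inner_le_norm one |s|
    rw [L2.inner_indicatorConstLp_one, Measure.restrict_univ, integral_congr_ae (Lp.coeFn_abs s),
      norm_abs_eq_norm] at this
    exact this
  let Φ : Lp ℝ 2 κ →L[ℝ] ℝ := Λ.mkContinuous ‖one‖ (by
    intro s
    rw [Real.norm_eq_abs, abs_le]
    refine ⟨?_, hL2 s⟩
    have := hL2 (-s)
    rw [map_neg, norm_neg] at this
    linarith)
  refine ⟨(InnerProductSpace.toDual ℝ _).symm Φ, fun s y h => ?_⟩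
  have h1 := InnerProductSpace.toDual_symm_apply (𝕜 := ℝ) (x := s) (y := Φ)
  rw [L2.inner_def] at h1
  have h2 : Φ s = Λ s := rfl
  refine le_trans (le_of_eq ?_) (hΛ s y h)
  rw [← h2, ← h1]
  congr 1
  ext x
  simp [mul_comm]

end

section
variable {Ω₁ Ω₂ : Type*} [MeasurableSpace Ω₁] [MeasurableSpace Ω₂]
  {μ₁ : Measure Ω₁} {μ₂ : Measure Ω₂} {a b : ℝ} {κ : Measure (Ω₁ × Ω₂)} {ρ : Ω₁ × Ω₂ → ℝ≥0}

lemma exists_trunc [IsFiniteMeasure κ] (hρ : Measurable ρ) {A : Set (Ω₁ × Ω₂)}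
    (hA : MeasurableSet A) (n : ℕ) (hn : ∀ x ∈ A, ρ x ≤ n) :
    ∃ s : Lp ℝ 2 κ, (∀ᵐ x ∂κ, s x = A.indicator (fun x => (ρ x : ℝ)) x) ∧
      ENNReal.ofReal (∫ x, s x ∂κ) = ∫⁻ x in A, (ρ x : ℝ≥0∞) ∂κ := by
  have hm : Measurable (A.indicator (fun x => (ρ x : ℝ))) := hρ.coe_nnreal_real.indicator hA
  have hmem : MemLp (A.indicator (fun x => (ρ x : ℝ))) 2 κ := by
    refine MemLp.of_bound hm.aestronglyMeasurable n (Filter.Eventually.of_forall fun x => ?_)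
    by_cases hx : x ∈ A
    · simpa [hx] using (by exact_mod_cast hn x hx : (ρ x : ℝ) ≤ n)
    · simp [hx]
  refine ⟨hmem.toLp, hmem.coeFn_toLp, ?_⟩
  rw [integral_congr_ae hmem.coeFn_toLp, ofReal_integral_eq_lintegral_ofReal
    (hmem.integrable (by norm_num))
    (Filter.Eventually.of_forall fun x => Set.indicator_nonneg (fun _ _ => by positivity) x),
    ← lintegral_indicator hA]
  congr 1
  ext x
  by_cases hx : x ∈ A <;> simp [hx]

lemma Lp_mul_int (θ s : Lp ℝ 2 κ) : Integrable (fun x => θ x * s x) κ := by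
  have := L2.integrable_inner (𝕜 := ℝ) s θ
  simpa [mul_comm] using this

lemma sup_trunc (hρ : Measurable ρ) {A : Set (Ω₁ × Ω₂)} (hA : MeasurableSet A) {c : ℝ≥0∞}
    (h : ∀ n : ℕ, ∫⁻ x in A ∩ {x | ρ x ≤ n}, (ρ x : ℝ≥0∞) ∂κ ≤ c) :
    ∫⁻ x in A, (ρ x : ℝ≥0∞) ∂κ ≤ c := by
  have hU : A = ⋃ n : ℕ, A ∩ {x | ρ x ≤ n} := by
    ext x
    simp only [Set.mem_iUnion, Set.mem_inter_iff, Set.mem_ofPred_eq]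
    exact ⟨fun hx => (exists_nat_ge (ρ x)).imp fun n hn => ⟨hx, hn⟩, fun ⟨n, h⟩ => h.1⟩
  rw [hU, setLIntegral_iUnion_of_directed]
  · exact iSup_le h
  · refine Monotone.directed_le fun m n hmn x hx => ⟨hx.1, ?_⟩
    have h1 : ρ x ≤ m := hx.2
    have h2 : (m : ℝ≥0) ≤ n := by exact_mod_cast hmn
    exact h1.trans h2

lemma core [IsFiniteMeasure κ]
    (ha0 : 0 < a) (ha1 : a ≤ 1) (hb0 : 0 < b) (hb1 : b ≤ 1) (hρ : Measurable ρ)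
    (hbd : ∀ (E₁ : Set Ω₁) (E₂ : Set Ω₂), MeasurableSet E₁ → MeasurableSet E₂ →
      μ₁ E₁ < ∞ → μ₂ E₂ < ∞ →
      ∫⁻ x in E₁ ×ˢ E₂, (ρ x : ℝ≥0∞) ∂κ ≤ μ₁ E₁ ^ a + μ₂ E₂ ^ b) :
    ∃ T : Set (Ω₁ × Ω₂), MeasurableSet T ∧
      (∀ E : Set Ω₁, MeasurableSet E → μ₁ E < ∞ →
        ∫⁻ x in T ∩ Prod.fst ⁻¹' E, (ρ x : ℝ≥0∞) ∂κ ≤ 2 * μ₁ E ^ a) ∧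
      (∀ F : Set Ω₂, MeasurableSet F → μ₂ F < ∞ →
        ∫⁻ x in Tᶜ ∩ Prod.snd ⁻¹' F, (ρ x : ℝ≥0∞) ∂κ ≤ 2 * μ₂ F ^ b) := by
  obtain ⟨θ, hθ⟩ := exists_density ha0 ha1 hb0 hb1 hρ hbd
  have hT : MeasurableSet {x | (1 / 2 : ℝ) ≤ θ x} :=
    measurableSet_le measurable_const (Lp.stronglyMeasurable θ).measurable
  have hn : ∀ n : ℕ, MeasurableSet {x | ρ x ≤ n} := fun n =>
    measurableSet_le hρ measurable_const
  refine ⟨_, hT, fun E hE hEf => ?_, fun F hF hFf => ?_⟩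
  · have hA := hT.inter (measurable_fst hE : MeasurableSet (Prod.fst ⁻¹' E : Set (Ω₁ × Ω₂)))
    have hEa : μ₁ E ^ a ≠ ∞ := (ENNReal.rpow_lt_top_of_nonneg ha0.le hEf.ne).ne
    refine sup_trunc hρ hA fun n => ?_
    obtain ⟨s, hs, hsi⟩ := exists_trunc (κ := κ) hρ (hA.inter (hn n)) n (fun x hx => hx.2)
    have hK : K μ₁ μ₂ a b κ ρ (s, (μ₁ E ^ a).toReal) := by
      refine ⟨_, _, _, _, 0, Cost.step _ _ 1 E Cost.zero zero_le_one hE hEf, Cost.zero, ?_, ?_, ?_⟩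
      · filter_upwards [Lp.coeFn_zero ℝ 2 κ] with x a1
        rw [a1]; simp
      · filter_upwards [Lp.coeFn_zero ℝ 2 κ, hs] with x a1 a2
        rw [a1, a2]
        by_cases hx : x.1 ∈ E
        · simp only [Pi.zero_apply, add_zero, Pi.add_apply, zero_add, hx, Set.indicator_of_mem,
            mul_one]
          exact Set.indicator_le_self' (fun _ _ => by positivity) x
        · have : x ∉ ({x | (1 / 2 : ℝ) ≤ θ x} ∩ Prod.fst ⁻¹' E) ∩ {x | ρ x ≤ n} :=
            fun h => hx h.1.2
          rw [Set.indicator_of_notMem this]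
          simp [hx]
      · rw [integral_congr_ae (Lp.coeFn_zero ℝ 2 κ)]
        simp
    have h1 := hθ _ _ hK
    have h2 : ∫ x, (1 / 2) * s x ∂κ ≤ ∫ x, θ x * s x ∂κ := by
      refine integral_mono_ae ((Lp_int s).const_mul _) (Lp_mul_int θ s) ?_
      filter_upwards [hs] with x a2
      simp only [a2]
      by_cases hx : x ∈ ({x | (1 / 2 : ℝ) ≤ θ x} ∩ Prod.fst ⁻¹' E) ∩ {x | ρ x ≤ n}
      · rw [Set.indicator_of_mem hx]
        exact mul_le_mul_of_nonneg_right hx.1.1 (by positivity)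
      · rw [Set.indicator_of_notMem hx]; simp
    rw [integral_const_mul] at h2
    rw [← hsi]
    calc ENNReal.ofReal (∫ x, s x ∂κ) ≤ ENNReal.ofReal (2 * (μ₁ E ^ a).toReal) :=
          ENNReal.ofReal_le_ofReal (by linarith)
      _ = 2 * μ₁ E ^ a := by
          rw [ENNReal.ofReal_mul (by norm_num), ENNReal.ofReal_toReal hEa]; simp
  · have hA := hT.compl.inter
      (measurable_snd hF : MeasurableSet (Prod.snd ⁻¹' F : Set (Ω₁ × Ω₂)))
    have hFa : μ₂ F ^ b ≠ ∞ := (ENNReal.rpow_lt_top_of_nonneg hb0.le hFf.ne).ne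
    refine sup_trunc hρ hA fun n => ?_
    obtain ⟨s, hs, hsi⟩ := exists_trunc (κ := κ) hρ (hA.inter (hn n)) n (fun x hx => hx.2)
    have hK : K μ₁ μ₂ a b κ ρ (-s, (μ₂ F ^ b).toReal - ∫ x, s x ∂κ) := by
      refine ⟨_, _, _, _, s, Cost.zero, Cost.step _ _ 1 F Cost.zero zero_le_one hF hFf, ?_, ?_, ?_⟩
      · filter_upwards [hs] with x a2
        rw [a2]
        by_cases hx : x.2 ∈ F
        · simp only [Pi.zero_apply, Pi.add_apply, zero_add, hx, Set.indicator_of_mem,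
            mul_one]
          exact Set.indicator_le_self' (fun _ _ => by positivity) x
        · have : x ∉ ({x | (1 / 2 : ℝ) ≤ θ x}ᶜ ∩ Prod.snd ⁻¹' F) ∩ {x | ρ x ≤ n} :=
            fun h => hx h.1.2
          rw [Set.indicator_of_notMem this]
          simp [hx]
      · filter_upwards [Lp.coeFn_neg s] with x a1
        rw [a1]; simp
      · simp
    have h1 := hθ _ _ hK
    have h0 : ∫ x, θ x * (-s : Lp ℝ 2 κ) x ∂κ = - ∫ x, θ x * s x ∂κ := by
      rw [← integral_neg]
      refine integral_congr_ae ?_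
      filter_upwards [Lp.coeFn_neg s] with x a1
      rw [a1]; simp
    have h2 : ∫ x, θ x * s x ∂κ ≤ ∫ x, (1 / 2) * s x ∂κ := by
      refine integral_mono_ae (Lp_mul_int θ s) ((Lp_int s).const_mul _) ?_
      filter_upwards [hs] with x a2
      simp only [a2]
      by_cases hx : x ∈ ({x | (1 / 2 : ℝ) ≤ θ x}ᶜ ∩ Prod.snd ⁻¹' F) ∩ {x | ρ x ≤ n}
      · rw [Set.indicator_of_mem hx]
        exact mul_le_mul_of_nonneg_right (le_of_lt (not_le.1 hx.1.1)) (by positivity)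
      · rw [Set.indicator_of_notMem hx]; simp
    rw [integral_const_mul] at h2
    rw [← hsi]
    calc ENNReal.ofReal (∫ x, s x ∂κ) ≤ ENNReal.ofReal (2 * (μ₂ F ^ b).toReal) :=
          ENNReal.ofReal_le_ofReal (by linarith)
      _ = 2 * μ₂ F ^ b := by
          rw [ENNReal.ofReal_mul (by norm_num), ENNReal.ofReal_toReal hFa]; simp

end

lemma expo {p p' : ℝ} (hp : 1 < p) (hp' : p' = p / (p - 1)) : 0 < 1 / p' ∧ 1 / p' ≤ 1 := by
  have h : 0 < p - 1 := by linarith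
  rw [hp', one_div_div]
  exact ⟨by positivity, by rw [div_le_one (by linarith)]; linarith⟩

lemma final_bound {a : ℝ} (ha : 0 < a) {m I : ℝ≥0∞} (h0 : 0 < m) (hm : m < ∞)
    (h : I ≤ 2 * m ^ a) : m ^ (-a) * I ≤ 4 := by
  calc m ^ (-a) * I ≤ m ^ (-a) * (2 * m ^ a) := by gcongr
    _ = 2 * (m ^ (-a) * m ^ a) := by ring
    _ = 2 := by
      rw [← ENNReal.rpow_add _ _ h0.ne' hm.ne]; simp
    _ ≤ 4 := by norm_num

end DecompAux

/-- Decomposition for a general exponent `q`: if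
`∫_{E₁×E₂} |f|^q ≤ μ₁(E₁)^{1/p₁'} + μ₂(E₂)^{1/p₂'}` for all measurable sets of finite measure,
then `f = f₁ + f₂` a.e. where
`sup_E μ₁(E)^{-1/p₁'} ∫_E ∫ |f₁|^q dμ₂ dμ₁ ≤ 4` and
`sup_E μ₂(E)^{-1/p₂'} ∫_E ∫ |f₂|^q dμ₁ dμ₂ ≤ 4`;
in other words `f₁ ∈ L_{qp₁,∞}(μ₁;L_q(μ₂))` and `f₂ ∈ L_{qp₂,∞}(μ₂;L_q(μ₁))`. -/
theorem decomposition_general_q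
    {Ω₁ Ω₂ : Type*} [MeasurableSpace Ω₁] [MeasurableSpace Ω₂]
    (μ₁ : Measure Ω₁) (μ₂ : Measure Ω₂) [SigmaFinite μ₁] [SigmaFinite μ₂]
    (q p₁ p₂ p₁' p₂' : ℝ) (hq : 0 < q) (hp₁ : 1 < p₁) (hp₂ : 1 < p₂)
    (hp₁' : p₁' = p₁ / (p₁ - 1)) (hp₂' : p₂' = p₂ / (p₂ - 1))
    (f : Ω₁ × Ω₂ → ℝ) (hf : Measurable f)
    (hbound : ∀ E₁ E₂ : Set _, MeasurableSet E₁ → MeasurableSet E₂ →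
      μ₁ E₁ < ∞ → μ₂ E₂ < ∞ →
      ∫⁻ x in E₁ ×ˢ E₂, (‖f x‖₊ : ℝ≥0∞) ^ q ∂(μ₁.prod μ₂)
        ≤ μ₁ E₁ ^ (1 / p₁') + μ₂ E₂ ^ (1 / p₂')) :
    ∃ f₁ f₂ : Ω₁ × Ω₂ → ℝ, Measurable f₁ ∧ Measurable f₂ ∧
      f =ᵐ[μ₁.prod μ₂] f₁ + f₂ ∧
      (⨆ (E : Set Ω₁) (_ : MeasurableSet E) (_ : 0 < μ₁ E) (_ : μ₁ E < ∞),
        μ₁ E ^ (-(1 / p₁')) *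
          ∫⁻ ω₁ in E, (∫⁻ ω₂, (‖f₁ (ω₁, ω₂)‖₊ : ℝ≥0∞) ^ q ∂μ₂) ∂μ₁) ≤ 4 ∧
      (⨆ (E : Set Ω₂) (_ : MeasurableSet E) (_ : 0 < μ₂ E) (_ : μ₂ E < ∞),
        μ₂ E ^ (-(1 / p₂')) *
          ∫⁻ ω₂ in E, (∫⁻ ω₁, (‖f₂ (ω₁, ω₂)‖₊ : ℝ≥0∞) ^ q ∂μ₁) ∂μ₂) ≤ 4 := by
  obtain ⟨ha0, ha1⟩ := DecompAux.expo hp₁ hp₁'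
  obtain ⟨hb0, hb1⟩ := DecompAux.expo hp₂ hp₂'
  obtain ⟨k, hk0, hkm, hki⟩ :=
    exists_pos_lintegral_lt_of_sigmaFinite (μ₁.prod μ₂) (one_ne_zero : (1 : ℝ≥0∞) ≠ 0)
  let κ : Measure (Ω₁ × Ω₂) := (μ₁.prod μ₂).withDensity fun x => (k x : ℝ≥0∞)
  have hκ : IsFiniteMeasure κ := isFiniteMeasure_withDensity (hki.trans one_lt_top).ne
  let ρ : Ω₁ × Ω₂ → NNReal := fun x => ‖f x‖₊ ^ q / k x
  have hρ : Measurable ρ := (hf.nnnorm.pow_const q).div hkm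
  have hconv : ∀ A : Set (Ω₁ × Ω₂), MeasurableSet A →
      ∫⁻ x in A, (ρ x : ℝ≥0∞) ∂κ = ∫⁻ x in A, (‖f x‖₊ : ℝ≥0∞) ^ q ∂(μ₁.prod μ₂) := by
    intro A hA
    rw [setLIntegral_withDensity_eq_setLIntegral_mul _ hkm.coe_nnreal_ennreal
      hρ.coe_nnreal_ennreal hA]
    congr 1
    ext x
    rw [← ENNReal.coe_rpow_of_nonneg _ hq.le]
    simp only [Pi.mul_apply, ρ]
    rw [← ENNReal.coe_mul, mul_div_cancel₀ _ (hk0 x).ne']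
  obtain ⟨T, hT, h1, h2⟩ := DecompAux.core (μ₁ := μ₁) (μ₂ := μ₂) (κ := κ) ha0 ha1 hb0 hb1 hρ (by
    intro E₁ E₂ hE₁ hE₂ hf₁ hf₂
    rw [hconv _ (hE₁.prod hE₂)]
    exact hbound E₁ E₂ hE₁ hE₂ hf₁ hf₂)
  have hind : ∀ (S B : Set (Ω₁ × Ω₂)), MeasurableSet S → MeasurableSet B →
      ∫⁻ x in B, (‖S.indicator f x‖₊ : ℝ≥0∞) ^ q ∂(μ₁.prod μ₂)
        = ∫⁻ x in S ∩ B, (‖f x‖₊ : ℝ≥0∞) ^ q ∂(μ₁.prod μ₂) := by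
    intro S B hS hB
    rw [← lintegral_indicator hB, ← lintegral_indicator (hS.inter hB)]
    congr 1
    ext x
    by_cases hxS : x ∈ S <;> by_cases hxB : x ∈ B <;> simp [hxS, hxB, hq]
  have hmeas : ∀ (S : Set (Ω₁ × Ω₂)), MeasurableSet S →
      Measurable fun x => (‖S.indicator f x‖₊ : ℝ≥0∞) ^ q := fun S hS =>
    (hf.indicator hS).nnnorm.coe_nnreal_ennreal.pow_const q
  refine ⟨T.indicator f, Tᶜ.indicator f, hf.indicator hT, hf.indicator hT.compl, ?_, ?_, ?_⟩
  · rw [Set.indicator_self_add_compl]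
  · refine iSup_le fun E => iSup_le fun hE => iSup_le fun hE0 => iSup_le fun hEf => ?_
    refine DecompAux.final_bound ha0 hE0 hEf ?_
    have e : ∫⁻ ω₁ in E, (∫⁻ ω₂, (‖T.indicator f (ω₁, ω₂)‖₊ : ℝ≥0∞) ^ q ∂μ₂) ∂μ₁
        = ∫⁻ x in Prod.fst ⁻¹' E, (‖T.indicator f x‖₊ : ℝ≥0∞) ^ q ∂(μ₁.prod μ₂) := by
      rw [← lintegral_prod _ (hmeas T hT).aemeasurable, ← Set.prod_univ,
        ← Measure.prod_restrict, Measure.restrict_univ]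
    rw [e, hind _ _ hT (measurable_fst hE), ← hconv _ (hT.inter (measurable_fst hE))]
    exact h1 E hE hEf
  · refine iSup_le fun E => iSup_le fun hE => iSup_le fun hE0 => iSup_le fun hEf => ?_
    refine DecompAux.final_bound hb0 hE0 hEf ?_
    have e : ∫⁻ ω₂ in E, (∫⁻ ω₁, (‖Tᶜ.indicator f (ω₁, ω₂)‖₊ : ℝ≥0∞) ^ q ∂μ₁) ∂μ₂
        = ∫⁻ x in Prod.snd ⁻¹' E, (‖Tᶜ.indicator f x‖₊ : ℝ≥0∞) ^ q ∂(μ₁.prod μ₂) := by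
      rw [← lintegral_prod_symm _ (hmeas _ hT.compl).aemeasurable, ← Set.univ_prod,
        ← Measure.prod_restrict, Measure.restrict_univ]
    rw [e, hind _ _ hT.compl (measurable_snd hE), ← hconv _ (hT.compl.inter (measurable_snd hE))]
    exact h2 E hE hEf
end

section
/- (Hahn–Banach-type reformulation of the decomposition lemma.) Let 1 < p₁, p₂ < ∞ with pⱼ' = pⱼ/(pⱼ−1). Suppose f : Ω₁ × Ω₂ → ℝ is measurable and for every pair of measurable sets E₁ ⊆ Ω₁, E₂ ⊆ Ω₂ of finite measure one has ∫_{E₁×E₂} |f| d(μ₁×μ₂) ≤ μ₁(E₁)^{1/p₁'} + μ₂(E₂)^{1/p₂'}. Then there exist measurable f₁, f₂ with f = f₁ + f₂ (μ₁×μ₂)-almost everywhere such that for every pair of measurable sets E₁ ⊆ Ω₁, E₂ ⊆ Ω₂ of finite measure: ∫_{E₁×E₂} |f₁| d(μ₁×μ₂) ≤ 2 μ₁(E₁)^{1/p₁'} and ∫_{E₁×E₂} |f₂| d(μ₁×μ₂) ≤ 2 μ₂(E₂)^{1/p₂'}. -/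
open MeasureTheory ENNReal NNReal

section Helpers
open Set

/-- submodularity for reals -/
lemma rpow_submod_real {a x y z w : ℝ} (ha0 : 0 ≤ a) (ha1 : a ≤ 1) (hx : 0 ≤ x) (hxy : x ≤ y)
    (hxz : x ≤ z) (hw : w + x = y + z) : w ^ a + x ^ a ≤ y ^ a + z ^ a := by
  rcases eq_or_lt_of_le (show x ≤ w by linarith) with h | h
  · have h1 : y = x := by linarith
    have h2 : z = x := by linarith
    rw [h1, h2, ← h]
  have hc := (Real.concaveOn_rpow ha0 ha1).2
  have hd : 0 < w - x := by linarith
  have e1 : (w - y) / (w - x) + (y - x) / (w - x) = 1 := by field_simp; ring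
  have n1 : 0 ≤ (w - y) / (w - x) := div_nonneg (by linarith) hd.le
  have n2 : 0 ≤ (y - x) / (w - x) := div_nonneg (by linarith) hd.le
  have hxI : x ∈ Set.Ici (0 : ℝ) := hx
  have hwI : w ∈ Set.Ici (0 : ℝ) := by simp only [Set.mem_Ici]; linarith
  have A := hc hxI hwI n1 n2 e1
  have B := hc hxI hwI n2 n1 (by linarith)
  simp only [smul_eq_mul] at A B
  have ey : (w - y) / (w - x) * x + (y - x) / (w - x) * w = y := by field_simp; ring
  have ez : (y - x) / (w - x) * x + (w - y) / (w - x) * w = z := by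
    have : z = w + x - y := by linarith
    rw [this]; field_simp; ring
  rw [ey] at A; rw [ez] at B
  have : ((w - y) / (w - x) + (y - x) / (w - x)) * (x ^ a + w ^ a) ≤ y ^ a + z ^ a := by
    nlinarith
  rw [e1] at this; linarith

lemma rpow_submod {a : ℝ} {x y z w : ℝ≥0∞} (ha0 : 0 < a) (ha1 : a ≤ 1) (hxy : x ≤ y)
    (hxz : x ≤ z) (hw : w + x = y + z) : w ^ a + x ^ a ≤ y ^ a + z ^ a := by
  by_cases hy : y = ∞
  · simp [hy, ENNReal.top_rpow_of_pos ha0]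
  by_cases hz : z = ∞
  · simp [hz, ENNReal.top_rpow_of_pos ha0]
  have hxt : x ≠ ∞ := ne_top_of_le_ne_top hy hxy
  have hwt : w ≠ ∞ := by
    rintro rfl
    have : y + z ≠ ∞ := ENNReal.add_ne_top.2 ⟨hy, hz⟩
    rw [← hw] at this; simp at this
  lift x to ℝ≥0 using hxt
  lift y to ℝ≥0 using hy
  lift z to ℝ≥0 using hz
  lift w to ℝ≥0 using hwt
  norm_cast at hxy hxz hw
  rw [← ENNReal.coe_rpow_of_nonneg _ ha0.le, ← ENNReal.coe_rpow_of_nonneg _ ha0.le,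
    ← ENNReal.coe_rpow_of_nonneg _ ha0.le, ← ENNReal.coe_rpow_of_nonneg _ ha0.le]
  norm_cast
  have := rpow_submod_real ha0.le ha1 x.2 (NNReal.coe_le_coe.2 hxy) (NNReal.coe_le_coe.2 hxz)
    (by exact_mod_cast hw : (w : ℝ) + x = y + z)
  exact_mod_cast this

lemma meas_submod {Ω : Type*} [MeasurableSpace Ω] (μ : Measure Ω) {a : ℝ} (ha0 : 0 < a)
    (ha1 : a ≤ 1) (A B : Set Ω) (hB : MeasurableSet B) :
    μ (A ∪ B) ^ a + μ (A ∩ B) ^ a ≤ μ A ^ a + μ B ^ a :=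
  rpow_submod ha0 ha1 (measure_mono Set.inter_subset_left) (measure_mono Set.inter_subset_right)
    (measure_union_add_inter A hB)

/-- distribution functional -/
noncomputable def distJ {Ω : Type*} [MeasurableSpace Ω] (μ : Measure Ω) (a : ℝ) (g : Ω → ℝ) :
    ℝ≥0∞ := ∫⁻ t in Ioi (0 : ℝ), μ {x | t < g x} ^ a

lemma meas_anti {Ω : Type*} [MeasurableSpace Ω] (μ : Measure Ω) {a : ℝ} (ha0 : 0 ≤ a)
    (S : ℝ → Set Ω) (hS : Antitone S) : Measurable fun t => μ (S t) ^ a := by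
  apply Antitone.measurable
  intro s t hst
  exact ENNReal.rpow_le_rpow (measure_mono (hS hst)) ha0

lemma distJ_add {Ω : Type*} [MeasurableSpace Ω] (μ : Measure Ω) {a : ℝ} (ha0 : 0 < a)
    (ha1 : a ≤ 1) (g : Ω → ℝ) (hg : Measurable g) (hg0 : ∀ x, 0 ≤ g x) (hJ : distJ μ a g ≠ ∞)
    (r : ℝ) (hr : 0 ≤ r) (E : Set Ω) (hE : MeasurableSet E) :
    distJ μ a (g + E.indicator fun _ => r) ≤ distJ μ a g + ENNReal.ofReal r * μ E ^ a := by
  set I := ∫⁻ t in Ioi (0 : ℝ), μ (E ∩ {x | t < g x}) ^ a with hI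
  have anti : Antitone fun t : ℝ => E ∩ {x | t < g x} := by
    intro s t hst x hx
    exact ⟨hx.1, lt_of_le_of_lt hst hx.2⟩
  have hm := meas_anti μ ha0.le _ anti
  have hIJ : I ≤ distJ μ a g :=
    lintegral_mono fun t => ENNReal.rpow_le_rpow (measure_mono Set.inter_subset_right) ha0.le
  have hIt : I ≠ ∞ := ne_top_of_le_ne_top hJ hIJ
  have key : distJ μ a (g + E.indicator fun _ => r) + I ≤
      distJ μ a g + ∫⁻ t in Ioi (0 : ℝ), μ (E ∩ {x | t - r < g x}) ^ a := by
    unfold distJ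
    have hm2 : Measurable fun t : ℝ => μ (E ∩ {x | t - r < g x}) ^ a :=
      hm.comp (measurable_id.sub_const r)
    rw [hI, ← lintegral_add_right _ hm, ← lintegral_add_right _ hm2]
    refine lintegral_mono fun t => ?_
    have := meas_submod μ ha0 ha1 {x | t < g x} (E ∩ {x | t - r < g x})
      (hE.inter (measurableSet_lt measurable_const hg))
    convert this using 4
    · ext x
      by_cases hx : x ∈ E <;> simp [hx]
      constructor
      · intro h; right; linarith
      · rintro (h | h) <;> linarith
    · ext x
      simp only [mem_inter_iff, mem_ofPred_eq]
      constructor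
      · rintro ⟨h1, h2⟩; exact ⟨h2, h1, by linarith⟩
      · rintro ⟨h1, h2, h3⟩; exact ⟨h2, h1⟩
  have shift : ∫⁻ t in Ioi (0 : ℝ), μ (E ∩ {x | t - r < g x}) ^ a ≤
      ENNReal.ofReal r * μ E ^ a + I := by
    have e : ∫⁻ t in Ioi (0 : ℝ), μ (E ∩ {x | t - r < g x}) ^ a =
        ∫⁻ s in Ioi (-r), μ (E ∩ {x | s < g x}) ^ a := by
      rw [← lintegral_indicator measurableSet_Ioi, ← lintegral_indicator measurableSet_Ioi,
        ← lintegral_sub_right_eq_self ((Ioi (-r)).indicator _) r]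
      congr 1; ext t
      simp [Set.indicator]
    rw [e, ← Set.Ioc_union_Ioi_eq_Ioi (show -r ≤ 0 by linarith)]
    refine (lintegral_union_le _ _ _).trans ?_
    gcongr
    calc _ ≤ ∫⁻ s in Ioc (-r) 0, μ E ^ a :=
          lintegral_mono fun s => ENNReal.rpow_le_rpow (measure_mono Set.inter_subset_left) ha0.le
      _ = _ := by simp [mul_comm]
  have := key.trans (add_le_add_right shift (distJ μ a g))
  rw [← add_assoc] at this
  exact (ENNReal.add_le_add_iff_right hIt).1 this

/-- finite positive combinations of indicators with their cost -/
inductive Dom {Ω : Type*} [MeasurableSpace Ω] (μ : Measure Ω) (a : ℝ) : (Ω → ℝ) → ℝ → Prop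
  | zero : Dom μ a 0 0
  | add (g : Ω → ℝ) (t r : ℝ) (E : Set Ω) : Dom μ a g t → 0 ≤ r → MeasurableSet E → μ E < ∞ →
      Dom μ a (g + E.indicator fun _ => r) (t + r * (μ E ^ a).toReal)

section
variable {Ω : Type*} [MeasurableSpace Ω] {μ : Measure Ω} {a : ℝ}

lemma Dom.sum {g h : Ω → ℝ} {s t : ℝ} (hg : Dom μ a g s) (hh : Dom μ a h t) :
    Dom μ a (g + h) (s + t) := by
  induction hh with
  | zero => simpa using hg
  | add h t r E _ hr hE hE' ih =>
    rw [← add_assoc, ← add_assoc]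
    exact Dom.add _ _ _ _ ih hr hE hE'

lemma Dom.smul {g : Ω → ℝ} {s : ℝ} (hg : Dom μ a g s) {c : ℝ} (hc : 0 ≤ c) :
    Dom μ a (c • g) (c * s) := by
  induction hg with
  | zero => simpa using Dom.zero
  | add h t r E _ hr hE hE' ih =>
    have := Dom.add _ _ (c * r) E ih (mul_nonneg hc hr) hE hE'
    convert this using 1
    · ext x; by_cases hx : x ∈ E <;> simp [hx, mul_add]
    · ring

lemma Dom.props (ha0 : 0 < a) (ha1 : a ≤ 1) {g : Ω → ℝ} {s : ℝ} (hg : Dom μ a g s) :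
    Measurable g ∧ (∀ x, 0 ≤ g x) ∧ 0 ≤ s ∧ (∀ t > 0, μ {x | t < g x} < ∞) ∧
      distJ μ a g ≤ ENNReal.ofReal s := by
  induction hg with
  | zero =>
    refine ⟨measurable_const, fun _ => le_rfl, le_rfl, ?_, ?_⟩
    · intro t ht
      simp [not_lt.2 ht.le]
    · unfold distJ
      rw [setLIntegral_congr_fun (g := fun _ => 0) measurableSet_Ioi]
      · simp
      · intro t ht
        have ht' : (0 : ℝ) < t := ht
        simp [not_lt.2 ht'.le, ENNReal.zero_rpow_of_pos ha0]
  | add h t r E _ hr hE hE' ih =>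
    obtain ⟨h1, h2, h3, h4, h5⟩ := ih
    refine ⟨h1.add (measurable_const.indicator hE), fun x => add_nonneg (h2 x)
      (Set.indicator_nonneg (fun _ _ => hr) x), by positivity, ?_, ?_⟩
    · intro t ht
      refine lt_of_le_of_lt (measure_mono (t := {x | t < h x} ∪ E) ?_)
        (measure_union_lt_top (h4 t ht) hE')
      intro x hx
      by_cases hxE : x ∈ E
      · exact Or.inr hxE
      · left; simpa [hxE] using hx
    · refine (distJ_add μ ha0 ha1 h h1 h2 (ne_top_of_le_ne_top ENNReal.ofReal_ne_top h5) r hr E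
        hE).trans ?_
      rw [ENNReal.ofReal_add h3 (by positivity), ENNReal.ofReal_mul hr,
        ENNReal.ofReal_toReal (ENNReal.rpow_ne_top_of_nonneg ha0.le hE'.ne)]
      gcongr

end

lemma exists_measure_of_additive {Ω : Type*} [MeasurableSpace Ω] (ν : Measure Ω)
    [IsFiniteMeasure ν] (l : Set Ω → ℝ) (h0 : ∀ A, MeasurableSet A → 0 ≤ l A)
    (h1 : ∀ A, MeasurableSet A → l A ≤ ν.real A)
    (hadd : ∀ A B, MeasurableSet A → MeasurableSet B → Disjoint A B → l (A ∪ B) = l A + l B) :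
    ∃ m : Measure Ω, ∀ A, MeasurableSet A → m A = ENNReal.ofReal (l A) := by
  have hemp : l ∅ = 0 := by
    have := hadd ∅ ∅ .empty .empty (by simp)
    simp at this; exact this
  have hfin : ∀ (A : ℕ → Set Ω), (∀ i, MeasurableSet (A i)) → Pairwise (Function.onFun Disjoint A) →
      ∀ n, l (⋃ i ∈ Finset.range n, A i) = ∑ i ∈ Finset.range n, l (A i) := by
    intro A hA hd n
    induction n with
    | zero => simp [hemp]
    | succ n ih =>
      rw [Finset.sum_range_succ, ← ih, ← hadd _ _ (Finset.measurableSet_biUnion _ fun i _ => hA i)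
        (hA n)]
      · congr 1
        rw [Finset.range_add_one, Finset.set_biUnion_insert, Set.union_comm]
      · simp only [Set.disjoint_iUnion_left]
        intro i hi
        exact hd (by simp at hi; omega)
  refine ⟨Measure.ofMeasurable (fun A _ => ENNReal.ofReal (l A)) (by simp [hemp]) ?_, ?_⟩
  · intro A hA hd
    have hsum : HasSum (fun i => l (A i)) (l (⋃ i, A i)) := by
      rw [hasSum_iff_tendsto_nat_of_nonneg (fun i => h0 _ (hA i))]
      have hν : Filter.Tendsto (fun n => ν.real (⋃ i, A i) - ∑ i ∈ Finset.range n, ν.real (A i))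
          Filter.atTop (nhds 0) := by
        have : HasSum (fun i => ν.real (A i)) (ν.real (⋃ i, A i)) := by
          have := ENNReal.hasSum_toReal (f := fun i => ν (A i))
            (by rw [← measure_iUnion hd hA]; exact measure_ne_top _ _)
          rwa [← ENNReal.tsum_toReal_eq (fun i => measure_ne_top _ _),
            ← measure_iUnion hd hA] at this
        simpa using (this.tendsto_sum_nat.const_sub (ν.real (⋃ i, A i)))
      have hdiff : Filter.Tendsto (fun n => l (⋃ i, A i) - ∑ i ∈ Finset.range n, l (A i))
          Filter.atTop (nhds 0) := by
        refine squeeze_zero ?_ ?_ hν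
        all_goals
          intro n
          have hB : MeasurableSet (⋃ i ∈ Finset.range n, A i) :=
            Finset.measurableSet_biUnion _ fun i _ => hA i
          have hU : MeasurableSet (⋃ i, A i) := .iUnion hA
          have hsub : (⋃ i ∈ Finset.range n, A i) ⊆ ⋃ i, A i :=
            Set.iUnion_subset fun i => Set.iUnion_subset fun _ => Set.subset_iUnion A i
          have e := hadd _ _ hB (hU.diff hB) Set.disjoint_sdiff_right
          rw [Set.union_sdiff_cancel hsub, hfin A hA hd n] at e
        · have := h0 _ (hU.diff hB)
          linarith
        · have := h1 _ (hU.diff hB)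
          have e2 : ν.real ((⋃ i, A i) \ ⋃ i ∈ Finset.range n, A i) =
            ν.real (⋃ i, A i) - ∑ i ∈ Finset.range n, ν.real (A i) := by
            rw [measureReal_sdiff hsub hB, measureReal_biUnion_finset (fun i _ j _ hij => hd hij)
              (fun i _ => hA i)]
          linarith
      simpa using hdiff.const_sub (l (⋃ i, A i))
    rw [← hsum.tsum_eq, ENNReal.ofReal_tsum_of_nonneg (fun i => h0 _ (hA i)) hsum.summable]
  · intro A hA
    rw [Measure.ofMeasurable_apply _ hA]

/-- integrable functions as a submodule -/
def intSub {Ω : Type*} [MeasurableSpace Ω] (ν : Measure Ω) : Submodule ℝ (Ω → ℝ) where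
  carrier := {u | Integrable u ν}
  add_mem' := fun h1 h2 => Integrable.add h1 h2
  zero_mem' := integrable_zero _ _ _
  smul_mem' := fun c _ h => Integrable.smul c h

/-- the integral as a linear map -/
noncomputable def intLin {Ω : Type*} [MeasurableSpace Ω] (ν : Measure Ω) : intSub ν →ₗ[ℝ] ℝ where
  toFun u := ∫ x, u.1 x ∂ν
  map_add' u v := integral_add u.2 v.2
  map_smul' c u := integral_const_mul c _

section
variable {Ω₁ Ω₂ : Type*} [MeasurableSpace Ω₁] [MeasurableSpace Ω₂]

lemma weak_duality {μ₁ : Measure Ω₁} {μ₂ : Measure Ω₂} {a b : ℝ} (ha0 : 0 < a) (ha1 : a ≤ 1)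
    (hb0 : 0 < b) (hb1 : b ≤ 1) (ν : Measure (Ω₁ × Ω₂))
    (hν : ∀ E₁ E₂, MeasurableSet E₁ → MeasurableSet E₂ → μ₁ E₁ < ∞ → μ₂ E₂ < ∞ →
      ν (E₁ ×ˢ E₂) ≤ μ₁ E₁ ^ a + μ₂ E₂ ^ b)
    {g : Ω₁ → ℝ} {h : Ω₂ → ℝ} {s t : ℝ} (hg : Dom μ₁ a g s) (hh : Dom μ₂ b h t)
    (u : Ω₁ × Ω₂ → ℝ) (hu : Integrable u ν) (hug : ∀ x, u x ≤ g x.1) (huh : ∀ x, u x ≤ h x.2) :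
    ∫ x, u x ∂ν ≤ s + t := by
  obtain ⟨g1, g2, g3, g4, g5⟩ := hg.props ha0 ha1
  obtain ⟨h1, h2, h3, h4, h5⟩ := hh.props hb0 hb1
  have hmeas : Measurable fun x : Ω₁ × Ω₂ => min (g x.1) (h x.2) :=
    (g1.comp measurable_fst).min (h1.comp measurable_snd)
  have key : ∫⁻ x, ENNReal.ofReal (u x) ∂ν ≤ ENNReal.ofReal (s + t) := by
    calc _ ≤ ∫⁻ x, ENNReal.ofReal (min (g x.1) (h x.2)) ∂ν :=
          lintegral_mono fun x => ENNReal.ofReal_le_ofReal (le_min (hug x) (huh x))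
      _ = ∫⁻ t in Ioi (0 : ℝ), ν {x | t < min (g x.1) (h x.2)} :=
          lintegral_eq_lintegral_meas_lt ν (Filter.Eventually.of_forall fun x => le_min (g2 _) (h2 _))
            hmeas.aemeasurable
      _ ≤ ∫⁻ t in Ioi (0 : ℝ), (μ₁ {x | t < g x} ^ a + μ₂ {x | t < h x} ^ b) := by
          refine setLIntegral_mono' measurableSet_Ioi fun t ht => ?_
          have e : {x : Ω₁ × Ω₂ | t < min (g x.1) (h x.2)} = {x | t < g x} ×ˢ {x | t < h x} := by
            ext x; simp
          rw [e]
          exact hν _ _ (measurableSet_lt measurable_const g1) (measurableSet_lt measurable_const h1)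
            (g4 t ht) (h4 t ht)
      _ = distJ μ₁ a g + distJ μ₂ b h := by
          unfold distJ
          rw [lintegral_add_left]
          exact meas_anti μ₁ ha0.le (fun t => {x | t < g x})
            (fun s t hst x hx => lt_of_le_of_lt hst hx)
      _ ≤ ENNReal.ofReal s + ENNReal.ofReal t := add_le_add g5 h5
      _ = _ := (ENNReal.ofReal_add g3 h3).symm
  rw [integral_eq_lintegral_pos_part_sub_lintegral_neg_part hu]
  have := ENNReal.toReal_mono ENNReal.ofReal_ne_top key
  rw [ENNReal.toReal_ofReal (by positivity)] at this
  have h' := ENNReal.toReal_nonneg (a := ∫⁻ x, ENNReal.ofReal (-u x) ∂ν)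
  linarith

/-- the cone -/
def domCone (μ₁ : Measure Ω₁) (μ₂ : Measure Ω₂) (a b : ℝ) (ν : Measure (Ω₁ × Ω₂)) :
    PointedCone ℝ (intSub ν × intSub ν × ℝ) where
  carrier := {p | ∃ g h s t, Dom μ₁ a g s ∧ Dom μ₂ b h t ∧ (∀ x, p.1.1 x ≤ g x.1) ∧
    (∀ x, p.2.1.1 x ≤ h x.2) ∧ s + t ≤ p.2.2}
  add_mem' := by
    rintro p q ⟨g, h, s, t, h1, h2, h3, h4, h5⟩ ⟨g', h', s', t', h1', h2', h3', h4', h5'⟩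
    exact ⟨g + g', h + h', s + s', t + t', h1.sum h1', h2.sum h2',
      fun x => add_le_add (h3 x) (h3' x), fun x => add_le_add (h4 x) (h4' x), by
        simp only [Prod.snd_add]; linarith⟩
  zero_mem' := ⟨0, 0, 0, 0, .zero, .zero, fun _ => le_rfl, fun _ => le_rfl, by simp⟩
  smul_mem' := by
    rintro c p ⟨g, h, s, t, h1, h2, h3, h4, h5⟩
    refine ⟨(c : ℝ) • g, (c : ℝ) • h, c * s, c * t, h1.smul c.2, h2.smul c.2,
      fun x => mul_le_mul_of_nonneg_left (h3 x) c.2, fun x => mul_le_mul_of_nonneg_left (h4 x) c.2,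
      ?_⟩
    have := mul_le_mul_of_nonneg_left h5 c.2
    rw [mul_add] at this
    exact this

lemma exists_functionals {μ₁ : Measure Ω₁} {μ₂ : Measure Ω₂} {a b : ℝ} (ha0 : 0 < a) (ha1 : a ≤ 1)
    (hb0 : 0 < b) (hb1 : b ≤ 1) (ν : Measure (Ω₁ × Ω₂))
    (hν : ∀ E₁ E₂, MeasurableSet E₁ → MeasurableSet E₂ → μ₁ E₁ < ∞ → μ₂ E₂ < ∞ →
      ν (E₁ ×ˢ E₂) ≤ μ₁ E₁ ^ a + μ₂ E₂ ^ b) :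
    ∃ L₁ L₂ : intSub ν →ₗ[ℝ] ℝ, (∀ u, L₁ u + L₂ u = ∫ x, u.1 x ∂ν) ∧
      (∀ u : intSub ν, (∀ x, 0 ≤ u.1 x) → 0 ≤ L₁ u) ∧
      (∀ u : intSub ν, (∀ x, 0 ≤ u.1 x) → 0 ≤ L₂ u) ∧
      (∀ (u : intSub ν) E, MeasurableSet E → μ₁ E < ∞ →
        (∀ x, u.1 x ≤ E.indicator (fun _ => 1) x.1) → L₁ u ≤ (μ₁ E ^ a).toReal) ∧
      (∀ (u : intSub ν) E, MeasurableSet E → μ₂ E < ∞ →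
        (∀ x, u.1 x ≤ E.indicator (fun _ => 1) x.2) → L₂ u ≤ (μ₂ E ^ b).toReal) := by
  let V := intSub ν × intSub ν × ℝ
  let F : V →ₗ[ℝ] ℝ := LinearMap.snd ℝ _ _ ∘ₗ LinearMap.snd ℝ _ _ - intLin ν ∘ₗ LinearMap.fst ℝ _ _
  let D : Submodule ℝ V := LinearMap.ker (LinearMap.fst ℝ (intSub ν) (intSub ν × ℝ) -
    LinearMap.fst ℝ (intSub ν) ℝ ∘ₗ LinearMap.snd ℝ _ _)
  have hF : ∀ u v t, F (u, v, t) = t - ∫ x, u.1 x ∂ν := fun u v t => rfl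
  have hD : ∀ u v t, (u, v, t) ∈ D ↔ u = v := by
    intro u v t
    simp [D, sub_eq_zero]
  obtain ⟨G, hG1, hG2⟩ := riesz_extension (domCone μ₁ μ₂ a b ν) ⟨D, F.domRestrict D⟩ (by
    rintro ⟨⟨u, v, t⟩, hx⟩ ⟨g, h, s, s', h1, h2, h3, h4, h5⟩
    have : u = v := (hD _ _ _).1 hx
    subst this
    have := weak_duality ha0 ha1 hb0 hb1 ν hν h1 h2 u.1 u.2 h3 h4
    change 0 ≤ F (u, u, t)
    rw [hF]
    simp only at h5
    linarith) (by
    rintro ⟨u, v, t⟩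
    let w : intSub ν := ⟨fun x => -|u.1 x| - |v.1 x|, (Integrable.abs u.2).neg.sub (Integrable.abs v.2)⟩
    refine ⟨⟨(w, w, -t), (hD _ _ _).2 rfl⟩, 0, 0, 0, 0, .zero, .zero, fun x => ?_, fun x => ?_, ?_⟩
    · change -|u.1 x| - |v.1 x| + u.1 x ≤ 0
      have := le_abs_self (u.1 x)
      have := abs_nonneg (v.1 x)
      linarith
    · change -|u.1 x| - |v.1 x| + v.1 x ≤ 0
      have := le_abs_self (v.1 x)
      have := abs_nonneg (u.1 x)
      linarith
    · simp)
  have hGD : ∀ u t, G (u, u, t) = t - ∫ x, u.1 x ∂ν := fun u t =>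
    hG1 ⟨(u, u, t), (hD _ _ _).2 rfl⟩
  have hsplit : ∀ u v t, G (u, v, t) = G (u, 0, 0) + G (0, v, 0) + t := by
    intro u v t
    have e : ((u, v, t) : V) = (u, 0, 0) + (0, v, 0) + (0, 0, t) := by simp
    rw [e, map_add, map_add, hGD]
    simp
  let L₁ : intSub ν →ₗ[ℝ] ℝ := -(G ∘ₗ LinearMap.inl ℝ _ _)
  let L₂ : intSub ν →ₗ[ℝ] ℝ := -(G ∘ₗ LinearMap.inr ℝ _ _ ∘ₗ LinearMap.inl ℝ _ _)
  have hL₁ : ∀ u, L₁ u = - G (u, 0, 0) := fun u => rfl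
  have hL₂ : ∀ u, L₂ u = - G (0, u, 0) := fun u => rfl
  refine ⟨L₁, L₂, ?_, ?_, ?_, ?_, ?_⟩
  · intro u
    have := hGD u 0
    rw [hsplit] at this
    rw [hL₁, hL₂]; linarith
  · intro u hu
    have := hG2 (-u, 0, 0) ⟨0, 0, 0, 0, .zero, .zero, fun x => by simpa using hu x,
      fun x => le_rfl, by simp⟩
    have e := hL₁ (-u)
    rw [map_neg] at e
    linarith
  · intro u hu
    have := hG2 (0, -u, 0) ⟨0, 0, 0, 0, .zero, .zero, fun x => le_rfl, fun x => by simpa using hu x,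
      by simp⟩
    have e := hL₂ (-u)
    rw [map_neg] at e
    linarith
  · intro u E hE hE' hu
    have := hG2 (u, 0, (μ₁ E ^ a).toReal) ⟨_, 0, _, 0, Dom.add _ _ 1 E .zero zero_le_one hE hE',
      .zero, fun x => by simpa using hu x, fun x => le_rfl, by simp⟩
    rw [hsplit] at this
    have e0 : G (0, 0, 0) = 0 := map_zero G
    rw [hL₁]; linarith
  · intro u E hE hE' hu
    have := hG2 (0, u, (μ₂ E ^ b).toReal) ⟨0, _, 0, _, .zero, Dom.add _ _ 1 E .zero zero_le_one hE hE',
      fun x => le_rfl, fun x => by simpa using hu x, by simp⟩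
    rw [hsplit] at this
    have e0 : G (0, 0, 0) = 0 := map_zero G
    rw [hL₂]; linarith

end

/-- from a positive functional dominated by the integral to a measure -/
lemma exists_measure_of_functional {Ω : Type*} [MeasurableSpace Ω] (ν : Measure Ω) [SigmaFinite ν] :
    ∃ (D : ℕ → Set Ω) (hDm : ∀ n, MeasurableSet (D n))
      (hI : ∀ n A, MeasurableSet A → Integrable ((A ∩ D n).indicator fun _ => (1 : ℝ)) ν),
      Pairwise (Function.onFun Disjoint D) ∧
      (∀ A, MeasurableSet A → ν A = ∑' n, ENNReal.ofReal (∫ x, (A ∩ D n).indicator (fun _ => (1 : ℝ)) x ∂ν)) ∧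
      ∀ L : intSub ν →ₗ[ℝ] ℝ, (∀ u : intSub ν, (∀ x, 0 ≤ u.1 x) → 0 ≤ L u) →
      (∀ u : intSub ν, (∀ x, 0 ≤ u.1 x) → L u ≤ ∫ x, u.1 x ∂ν) →
      ∃ m : Measure Ω, ∀ A (hA : MeasurableSet A),
        m A = ∑' n, ENNReal.ofReal (L ⟨(A ∩ D n).indicator fun _ => 1, hI n A hA⟩) := by
  have hDm : ∀ n, MeasurableSet (disjointed (spanningSets ν) n) :=
    fun n => MeasurableSet.disjointed (measurableSet_spanningSets ν) n
  have hDf : ∀ n, ν (disjointed (spanningSets ν) n) < ∞ := fun n =>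
    lt_of_le_of_lt (measure_mono (disjointed_subset _ _)) (measure_spanningSets_lt_top ν n)
  generalize hDD : disjointed (spanningSets ν) = D at hDm hDf
  have hdis : Pairwise (Function.onFun Disjoint D) := by
    rw [← hDD]; exact disjoint_disjointed _
  have hun : ⋃ n, D n = univ := by
    rw [← hDD, iUnion_disjointed, iUnion_spanningSets]
  have hI : ∀ n A, MeasurableSet A → Integrable ((A ∩ D n).indicator fun _ => (1 : ℝ)) ν := by
    intro n A hA
    rw [integrable_indicator_iff (hA.inter (hDm n))]
    exact integrableOn_const (lt_of_le_of_lt (measure_mono Set.inter_subset_right) (hDf n)).ne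
  have hint : ∀ n A, MeasurableSet A →
      ∫ x, (A ∩ D n).indicator (fun _ => (1 : ℝ)) x ∂ν = ν.real (A ∩ D n) := by
    intro n A hA
    rw [integral_indicator (hA.inter (hDm n))]; simp
  refine ⟨D, hDm, hI, hdis, ?_, ?_⟩
  · intro A hA
    have : A = ⋃ n, A ∩ D n := by rw [← inter_iUnion, hun, inter_univ]
    conv_lhs => rw [this]
    rw [measure_iUnion _ (fun n => hA.inter (hDm n))]
    · congr 1; ext n
      rw [hint n A hA, ofReal_measureReal
        (lt_of_le_of_lt (measure_mono Set.inter_subset_right) (hDf n)).ne]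
    · intro i j hij
      exact (hdis hij).mono Set.inter_subset_right Set.inter_subset_right
  · intro L hL0 hL1
    have : ∀ n, ∃ m : Measure Ω, ∀ A (hA : MeasurableSet A),
        m A = ENNReal.ofReal (L ⟨(A ∩ D n).indicator fun _ => 1, hI n A hA⟩) := by
      intro n
      haveI : IsFiniteMeasure (ν.restrict (D n)) := ⟨by simpa using hDf n⟩
      classical
      obtain ⟨m, hm⟩ := exists_measure_of_additive (ν.restrict (D n))
        (fun A => if hA : MeasurableSet A then
          L ⟨(A ∩ D n).indicator fun _ => 1, hI n A hA⟩ else 0) (by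
        intro A hA
        simp only [hA, dite_true]
        exact hL0 _ fun x => Set.indicator_nonneg (fun _ _ => zero_le_one) x) (by
        intro A hA
        simp only [hA, dite_true]
        refine (hL1 _ fun x => Set.indicator_nonneg (fun _ _ => zero_le_one) x).trans ?_
        rw [hint n A hA, measureReal_restrict_apply hA]) (by
        intro A B hA hB hAB
        simp only [hA, hB, hA.union hB, dite_true]
        rw [← map_add]
        congr 1
        ext x
        have := hAB.mono (Set.inter_subset_left (t := D n)) (Set.inter_subset_left (t := D n))
        simp only [Set.union_inter_distrib_right, Set.indicator_union_of_disjoint this]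
        rfl)
      exact ⟨m, fun A hA => by rw [hm A hA]; simp only [hA, dite_true]⟩
    choose m hm using this
    refine ⟨Measure.sum m, fun A hA => ?_⟩
    rw [Measure.sum_apply _ hA]
    congr 1; ext n; exact hm n A hA

lemma tsum_functional_le {Ω : Type*} [MeasurableSpace Ω] (ν : Measure Ω)
    (D : ℕ → Set Ω) (hdis : Pairwise (Function.onFun Disjoint D))
    (hI : ∀ n A, MeasurableSet A → Integrable ((A ∩ D n).indicator fun _ => (1 : ℝ)) ν)
    (L : intSub ν →ₗ[ℝ] ℝ) (hL0 : ∀ u : intSub ν, (∀ x, 0 ≤ u.1 x) → 0 ≤ L u)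
    (A : Set Ω) (hA : MeasurableSet A) (C : ℝ≥0∞) (hC : C ≠ ∞)
    (hL : ∀ u : intSub ν, (∀ x, u.1 x ≤ A.indicator (fun _ => 1) x) → L u ≤ C.toReal) :
    ∑' n, ENNReal.ofReal (L ⟨(A ∩ D n).indicator fun _ => 1, hI n A hA⟩) ≤ C := by
  refine ENNReal.tsum_le_of_sum_range_le fun N => ?_
  rw [← ENNReal.ofReal_sum_of_nonneg, ← map_sum]
  · refine (ENNReal.ofReal_le_ofReal (hL _ fun x => ?_)).trans (ENNReal.ofReal_toReal hC).le
    have e : (∑ n ∈ Finset.range N, (⟨(A ∩ D n).indicator fun _ => 1, hI n A hA⟩ : intSub ν)).1 x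
        = ∑ n ∈ Finset.range N, (A ∩ D n).indicator (fun _ => (1 : ℝ)) x := by
      simp
    rw [e]
    have hd : Set.PairwiseDisjoint (Finset.range N : Set ℕ) fun n => A ∩ D n := fun i _ j _ hij =>
      (hdis hij).mono Set.inter_subset_right Set.inter_subset_right
    have e2 := Finset.indicator_biUnion (Finset.range N) (fun n => A ∩ D n) (f := fun _ : Ω => (1 : ℝ)) hd
    rw [← congrFun e2 x]
    refine Set.indicator_le_indicator_of_subset ?_ (fun _ => zero_le_one) x
    exact Set.iUnion₂_subset fun i _ => Set.inter_subset_left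
  · intro n _
    exact hL0 _ fun x => Set.indicator_nonneg (fun _ _ => zero_le_one) x

lemma exp_bounds {p p' : ℝ} (hp : 1 < p) (hp' : p' = p / (p - 1)) : 0 < 1 / p' ∧ 1 / p' ≤ 1 := by
  subst hp'
  rw [one_div_div]
  exact ⟨div_pos (by linarith) (by linarith), (div_le_one (by linarith)).2 (by linarith)⟩

lemma density_bound {Ω : Type*} [MeasurableSpace Ω] (μ m : Measure Ω) (f : Ω → ℝ)
    (hf : Measurable f) [SigmaFinite (μ.withDensity fun x => (‖f x‖₊ : ℝ≥0∞))] [SigmaFinite m]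
    (hm : m ≪ μ.withDensity fun x => (‖f x‖₊ : ℝ≥0∞)) (R : Set Ω) (hR : MeasurableSet R) :
    ∫⁻ x in R, ‖(m.rnDeriv (μ.withDensity fun x => (‖f x‖₊ : ℝ≥0∞)) x).toReal * f x‖₊ ∂μ ≤ m R := by
  set ν := μ.withDensity fun x => (‖f x‖₊ : ℝ≥0∞) with hν
  have hnf : Measurable fun x => (‖f x‖₊ : ℝ≥0∞) := hf.nnnorm.coe_nnreal_ennreal
  calc _ ≤ ∫⁻ x in R, ‖f x‖₊ * m.rnDeriv ν x ∂μ := by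
        refine lintegral_mono fun x => ?_
        rw [nnnorm_mul, ENNReal.coe_mul, mul_comm]
        gcongr
        rw [← enorm_eq_nnnorm, Real.enorm_eq_ofReal ENNReal.toReal_nonneg]
        exact ENNReal.ofReal_toReal_le
    _ = ∫⁻ x in R, m.rnDeriv ν x ∂ν := by
        rw [hν, restrict_withDensity hR, lintegral_withDensity_eq_lintegral_mul _ hnf
          (Measure.measurable_rnDeriv _ _)]
        rfl
    _ = m R := by
        rw [← withDensity_apply _ hR, Measure.withDensity_rnDeriv_eq _ _ hm]


end Helpers

/-- Hahn–Banach-type reformulation of the decomposition lemma: if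
`∫_{E₁×E₂} |f| ≤ μ₁(E₁)^{1/p₁'} + μ₂(E₂)^{1/p₂'}` for all measurable sets of finite measure,
then `f = f₁ + f₂` a.e. with `∫_{E₁×E₂} |f₁| ≤ 2 μ₁(E₁)^{1/p₁'}` and
`∫_{E₁×E₂} |f₂| ≤ 2 μ₂(E₂)^{1/p₂'}` for all such sets. -/
theorem hahn_banach_type_decomposition
    {Ω₁ Ω₂ : Type*} [MeasurableSpace Ω₁] [MeasurableSpace Ω₂]
    (μ₁ : Measure Ω₁) (μ₂ : Measure Ω₂) [SigmaFinite μ₁] [SigmaFinite μ₂]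
    (p₁ p₂ p₁' p₂' : ℝ) (hp₁ : 1 < p₁) (hp₂ : 1 < p₂)
    (hp₁' : p₁' = p₁ / (p₁ - 1)) (hp₂' : p₂' = p₂ / (p₂ - 1))
    (f : Ω₁ × Ω₂ → ℝ) (hf : Measurable f)
    (hbound : ∀ E₁ E₂ : Set _, MeasurableSet E₁ → MeasurableSet E₂ →
      μ₁ E₁ < ∞ → μ₂ E₂ < ∞ →
      ∫⁻ x in E₁ ×ˢ E₂, ‖f x‖₊ ∂(μ₁.prod μ₂) ≤ μ₁ E₁ ^ (1 / p₁') + μ₂ E₂ ^ (1 / p₂')) :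
    ∃ f₁ f₂ : Ω₁ × Ω₂ → ℝ, Measurable f₁ ∧ Measurable f₂ ∧
      f =ᵐ[μ₁.prod μ₂] f₁ + f₂ ∧
      (∀ E₁ E₂ : Set _, MeasurableSet E₁ → MeasurableSet E₂ →
        μ₁ E₁ < ∞ → μ₂ E₂ < ∞ →
        ∫⁻ x in E₁ ×ˢ E₂, ‖f₁ x‖₊ ∂(μ₁.prod μ₂) ≤ 2 * μ₁ E₁ ^ (1 / p₁')) ∧
      (∀ E₁ E₂ : Set _, MeasurableSet E₁ → MeasurableSet E₂ →
        μ₁ E₁ < ∞ → μ₂ E₂ < ∞ →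
        ∫⁻ x in E₁ ×ˢ E₂, ‖f₂ x‖₊ ∂(μ₁.prod μ₂) ≤ 2 * μ₂ E₂ ^ (1 / p₂')) := by
  obtain ⟨ha0, ha1⟩ := exp_bounds hp₁ hp₁'
  obtain ⟨hb0, hb1⟩ := exp_bounds hp₂ hp₂'
  set ν := (μ₁.prod μ₂).withDensity fun x => (‖f x‖₊ : ℝ≥0∞) with hνdef
  have hnf : Measurable fun x => (‖f x‖₊ : ℝ≥0∞) := hf.nnnorm.coe_nnreal_ennreal
  haveI : SigmaFinite ν := SigmaFinite.withDensity fun x => ‖f x‖₊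
  have hν : ∀ E₁ E₂, MeasurableSet E₁ → MeasurableSet E₂ → μ₁ E₁ < ∞ → μ₂ E₂ < ∞ →
      ν (E₁ ×ˢ E₂) ≤ μ₁ E₁ ^ (1 / p₁') + μ₂ E₂ ^ (1 / p₂') := by
    intro E₁ E₂ h1 h2 h3 h4
    rw [hνdef, withDensity_apply _ (h1.prod h2)]
    exact hbound E₁ E₂ h1 h2 h3 h4
  obtain ⟨L₁, L₂, hL, hp1, hp2, hb1', hb2'⟩ := exists_functionals ha0 ha1 hb0 hb1 ν hν
  obtain ⟨D, hDm, hI, hdis, hνD, hmeas⟩ := exists_measure_of_functional ν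
  obtain ⟨m₁, hm₁⟩ := hmeas L₁ hp1 fun u hu => by
    have := hL u; have := hp2 u hu; linarith
  obtain ⟨m₂, hm₂⟩ := hmeas L₂ hp2 fun u hu => by
    have := hL u; have := hp1 u hu; linarith
  have hsum : m₁ + m₂ = ν := by
    ext A hA
    rw [Measure.add_apply, hm₁ A hA, hm₂ A hA, hνD A hA, ← ENNReal.tsum_add]
    congr 1; ext n
    have hn : ∀ x, 0 ≤ (A ∩ D n).indicator (fun _ => (1 : ℝ)) x :=
      fun x => Set.indicator_nonneg (fun _ _ => zero_le_one) x
    rw [← ENNReal.ofReal_add (hp1 _ hn) (hp2 _ hn), hL]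
  have hle1 : m₁ ≤ ν := hsum ▸ Measure.le_add_right le_rfl
  have hle2 : m₂ ≤ ν := hsum ▸ Measure.le_add_left le_rfl
  haveI : SigmaFinite m₁ := Measure.sigmaFinite_of_le ν hle1
  haveI : SigmaFinite m₂ := Measure.sigmaFinite_of_le ν hle2
  have hR1 : ∀ E₁ E₂ : Set _, MeasurableSet E₁ → MeasurableSet E₂ → μ₁ E₁ < ∞ →
      m₁ (E₁ ×ˢ E₂) ≤ μ₁ E₁ ^ (1 / p₁') := by
    intro E₁ E₂ h1 h2 h3
    rw [hm₁ _ (h1.prod h2)]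
    refine tsum_functional_le ν D hdis hI L₁ hp1 _ (h1.prod h2) _
      (ENNReal.rpow_ne_top_of_nonneg ha0.le h3.ne) fun u hu => hb1' u E₁ h1 h3 fun x => ?_
    refine (hu x).trans ?_
    by_cases hx1 : x.1 ∈ E₁ <;> by_cases hx2 : x.2 ∈ E₂ <;> simp [Set.indicator, hx1, hx2]
  have hR2 : ∀ E₁ E₂ : Set _, MeasurableSet E₁ → MeasurableSet E₂ → μ₂ E₂ < ∞ →
      m₂ (E₁ ×ˢ E₂) ≤ μ₂ E₂ ^ (1 / p₂') := by
    intro E₁ E₂ h1 h2 h3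
    rw [hm₂ _ (h1.prod h2)]
    refine tsum_functional_le ν D hdis hI L₂ hp2 _ (h1.prod h2) _
      (ENNReal.rpow_ne_top_of_nonneg hb0.le h3.ne) fun u hu => hb2' u E₂ h2 h3 fun x => ?_
    refine (hu x).trans ?_
    by_cases hx1 : x.1 ∈ E₁ <;> by_cases hx2 : x.2 ∈ E₂ <;> simp [Set.indicator, hx1, hx2]
  refine ⟨fun x => (m₁.rnDeriv ν x).toReal * f x, fun x => (m₂.rnDeriv ν x).toReal * f x,
    (Measure.measurable_rnDeriv _ _).ennreal_toReal.mul hf,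
    (Measure.measurable_rnDeriv _ _).ennreal_toReal.mul hf, ?_, ?_, ?_⟩
  · have h1 : ∀ᵐ x ∂ν, (m₁.rnDeriv ν x).toReal + (m₂.rnDeriv ν x).toReal = 1 := by
      have hadd := Measure.rnDeriv_add' m₁ m₂ ν
      rw [hsum] at hadd
      filter_upwards [hadd, Measure.rnDeriv_self ν, Measure.rnDeriv_lt_top m₁ ν,
        Measure.rnDeriv_lt_top m₂ ν] with x e1 e2 e3 e4
      rw [e2, Pi.add_apply] at e1
      rw [← ENNReal.toReal_add e3.ne e4.ne, ← e1]; simp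
    rw [hνdef, ae_withDensity_iff hnf] at h1
    filter_upwards [h1] with x hx
    by_cases h0 : f x = 0
    · simp [h0]
    · have := hx (by simpa using h0)
      simp only [Pi.add_apply]
      rw [← add_mul, this, one_mul]
  · intro E₁ E₂ h1 h2 h3 h4
    refine (density_bound _ m₁ f hf (Measure.absolutelyContinuous_of_le hle1) _
      (h1.prod h2)).trans ((hR1 E₁ E₂ h1 h2 h3).trans ?_)
    exact le_mul_of_one_le_left zero_le one_le_two
  · intro E₁ E₂ h1 h2 h3 h4
    refine (density_bound _ m₂ f hf (Measure.absolutelyContinuous_of_le hle2) _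
      (h1.prod h2)).trans ((hR2 E₁ E₂ h1 h2 h4).trans ?_)
    exact le_mul_of_one_le_left zero_le one_le_two
end
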